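/- arXiv:2302.02247 — 2 statements merged into one kernel-verified Lean document; each statement's English description precedes it below -/
import Mathlib

section
/- Fix an integer d ≥ 1, reals β > 0 and L > 0, and an interior point θ₀ ∈ (−π,π)^d. Let 𝒞(β,L) be the set of functions C : ℤ^d → ℝ such that C(k) = C(−k) for all k, Σ_{k∈ℤ^d} (1 + ‖k‖₂^β)·|C(k)| ≤ L, and C is positive definite (for every finite F ⊂ ℤ^d the matrix (C(j−k))_{j,k∈F} is positive semidefinite). For C ∈ 𝒞(β,L) set f_C(θ₀) := (2π)^{−d} Σ_{k∈ℤ^d} C(k) e^{i k·θ₀} (a real number), and let P_{n,C} denote the centered Gaussian probability measure on ℝ^{T_n}, T_n := {1,…,n}^d, with covariance matrix (C(j−k))_{j,k∈T_n}. Then liminf_{n→∞} inf_{f̂_n} sup_{C∈𝒞(β,L)} P_{n,C}( { x ∈ ℝ^{T_n} : |f̂_n(x) − f_C(θ₀)| ≥ n^{−dβ/(2β+d)} } ) > 0, where the infimum is over all Borel measurable maps f̂_n : ℝ^{T_n} → ℝ. -/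
open MeasureTheory ProbabilityTheory Filter
open scoped Classical

/-- The Euclidean norm `‖k‖₂` of a multi-index `k ∈ ℤ^d`. -/
noncomputable def znorm {d : ℕ} (k : Fin d → ℤ) : ℝ := Real.sqrt (∑ i, ((k i : ℝ)) ^ 2)

/-- The power-law covariance class `P_D(β,L)` on `ℤ^d`: symmetric, with
`∑_k (1+‖k‖₂^β)|C(k)| ≤ L`, and positive definite. -/
def PLD (d : ℕ) (β L : ℝ) (C : (Fin d → ℤ) → ℝ) : Prop :=
  (∀ k, C k = C (-k)) ∧
  Summable (fun k : Fin d → ℤ => (1 + znorm k ^ β) * |C k|) ∧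
  (∑' k : Fin d → ℤ, (1 + znorm k ^ β) * |C k|) ≤ L ∧
  ∀ (F : Finset (Fin d → ℤ)) (x : (Fin d → ℤ) → ℝ),
    0 ≤ ∑ j ∈ F, ∑ k ∈ F, x j * C (j - k) * x k

/-- The value `f_C(θ₀) = (2π)^{-d} ∑_{k∈ℤ^d} C(k) e^{i k·θ₀}` of the spectral density
(a real number by the symmetry of `C`, obtained as the real part of the complex sum). -/
noncomputable def specVal (d : ℕ) (C : (Fin d → ℤ) → ℝ) (θ : Fin d → ℝ) : ℝ :=
  ((2 * Real.pi) ^ d)⁻¹ *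
    (∑' k : Fin d → ℤ, (C k : ℂ) * Complex.exp (Complex.I * ∑ i, (k i : ℝ) * θ i)).re

/-- `P` is the centered Gaussian measure on `ι → ℝ` with covariance matrix `S`:
a probability measure all of whose one-dimensional linear-functional pushforwards are
centered real Gaussians with the corresponding variance `xᵀSx`. -/
def IsCenteredGaussianCov {ι : Type*} [Fintype ι] (P : Measure (ι → ℝ))
    (S : Matrix ι ι ℝ) : Prop :=
  IsProbabilityMeasure P ∧
  ∀ x : ι → ℝ, Measure.map (fun ω => ∑ i, x i * ω i) P =
    gaussianReal 0 (∑ i, ∑ j, x i * S i j * x j).toNNReal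

/-- The product of measures with densities has the product density. -/
lemma pi_withDensity_eq {ι : Type*} [Fintype ι] {μ ν : ι → Measure ℝ}
    [∀ i, IsProbabilityMeasure (μ i)] [∀ i, IsProbabilityMeasure (ν i)]
    {r : ι → ℝ → ENNReal} (hr : ∀ i, Measurable (r i))
    (hν : ∀ i, ν i = (μ i).withDensity (r i)) :
    Measure.pi ν = (Measure.pi μ).withDensity (fun x => ∏ i, r i (x i)) := by
  refine Measure.pi_eq fun s hs => ?_
  have hm : ∀ i, Measurable ((s i).indicator (r i)) := fun i => (hr i).indicator (hs i)
  have hind : ∀ x : ι → ℝ, (Set.univ.pi s).indicator (fun x => ∏ i, r i (x i)) x =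
      ∏ i, (s i).indicator (r i) (x i) := by
    intro x
    by_cases hx : x ∈ Set.univ.pi s
    · rw [Set.indicator_of_mem hx]
      exact Finset.prod_congr rfl fun i _ => (Set.indicator_of_mem (hx i trivial) _).symm
    · rw [Set.indicator_of_notMem hx]
      simp only [Set.mem_pi, Set.mem_univ, true_imp_iff, not_forall] at hx
      obtain ⟨i, hi⟩ := hx
      exact (Finset.prod_eq_zero (Finset.mem_univ i) (Set.indicator_of_notMem hi _)).symm
  rw [withDensity_apply _ (MeasurableSet.univ_pi hs),
    ← lintegral_indicator (MeasurableSet.univ_pi hs), lintegral_congr hind,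
    lintegral_prod_eq_prod_lintegral_of_indepFun Finset.univ
      (fun i (x : ι → ℝ) => (s i).indicator (r i) (x i))
      (iIndepFun_pi fun i => (hm i).aemeasurable) (fun i => (hm i).comp (measurable_pi_apply i))]
  refine Finset.prod_congr rfl fun i _ => ?_
  rw [(measurePreserving_eval μ i).lintegral_comp (hm i), lintegral_indicator (hs i), hν i,
    withDensity_apply _ (hs i)]

/-- Cauchy-Schwarz for a change of measure. -/
lemma withDensity_sq_le {Ω : Type*} [MeasurableSpace Ω] (μ : Measure Ω) {r : Ω → ENNReal}
    (hr : Measurable r) {A : Set Ω} (hA : MeasurableSet A) :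
    (μ.withDensity r A) ^ 2 ≤ (∫⁻ x, r x ^ 2 ∂μ) * μ A := by
  have h := ENNReal.lintegral_mul_le_Lp_mul_Lq μ Real.HolderConjugate.two_two hr.aemeasurable
    (measurable_const.indicator hA : Measurable (A.indicator fun _ => (1 : ENNReal))).aemeasurable
  have h1 : ∫⁻ a, (r * A.indicator fun _ => (1 : ENNReal)) a ∂μ = μ.withDensity r A := by
    rw [withDensity_apply _ hA, ← lintegral_indicator hA]
    refine lintegral_congr fun x => ?_
    by_cases hx : x ∈ A <;> simp [hx]
  have h2 : ∫⁻ a, (A.indicator (fun _ => (1 : ENNReal)) a) ^ (2 : ℝ) ∂μ = μ A := by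
    rw [← lintegral_indicator_one hA]
    refine lintegral_congr fun x => ?_
    by_cases hx : x ∈ A <;> simp [hx]
  rw [h1, h2] at h
  calc (μ.withDensity r A) ^ 2
      ≤ ((∫⁻ a, r a ^ (2 : ℝ) ∂μ) ^ (1 / 2 : ℝ) * μ A ^ (1 / 2 : ℝ)) ^ 2 := by gcongr
    _ = _ := by
      rw [mul_pow, ← ENNReal.rpow_natCast, ← ENNReal.rpow_natCast, ← ENNReal.rpow_mul,
        ← ENNReal.rpow_mul]
      simp

/-- The density of `N(0, v)` with respect to `N(0, s)`. -/
noncomputable def gaussianRatio (s v : NNReal) (x : ℝ) : ENNReal :=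
  ENNReal.ofReal (gaussianPDFReal 0 v x / gaussianPDFReal 0 s x)

lemma measurable_gaussianRatio (s v : NNReal) : Measurable (gaussianRatio s v) :=
  ENNReal.measurable_ofReal.comp
    ((measurable_gaussianPDFReal 0 v).div (measurable_gaussianPDFReal 0 s))

lemma gaussianReal_eq_withDensity {s v : NNReal} (hs : s ≠ 0) (hv : v ≠ 0) :
    gaussianReal 0 v = (gaussianReal 0 s).withDensity (gaussianRatio s v) := by
  rw [gaussianReal_of_var_ne_zero 0 hs, gaussianReal_of_var_ne_zero 0 hv,
    ← withDensity_mul _ (measurable_gaussianPDF 0 s) (measurable_gaussianRatio s v)]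
  congr 1
  ext x
  have h := gaussianPDFReal_pos 0 s x hs
  rw [Pi.mul_apply, gaussianPDF, gaussianPDF, gaussianRatio, ← ENNReal.ofReal_mul h.le,
    mul_div_cancel₀ _ h.ne']

lemma lintegral_gaussianRatio_sq_le {s v : NNReal} (hs : s ≠ 0) {l : ℝ} (hl : |l| ≤ 1 / 2)
    (hv : (v : ℝ) = s * (1 + l)) :
    ∫⁻ x, gaussianRatio s v x ^ 2 ∂(gaussianReal 0 s) ≤ ENNReal.ofReal (Real.exp (l ^ 2)) := by
  obtain ⟨hl1, hl2⟩ := abs_le.mp hl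
  have hs0 : (0 : ℝ) < s := by positivity
  have hp : 0 < 1 + l := by linarith
  have hm : 0 < 1 - l := by linarith
  have hv0 : (0 : ℝ) < v := by rw [hv]; positivity
  set w : NNReal := ⟨s * (1 + l) / (1 - l), by positivity⟩ with hw
  have hwv : (w : ℝ) = s * (1 + l) / (1 - l) := rfl
  have hw0 : (0 : ℝ) < w := by rw [hwv]; positivity
  have hwne : w ≠ 0 := fun h => by simp [h] at hw0
  set c : ℝ := √(2 * Real.pi * s) * √(2 * Real.pi * w) / (2 * Real.pi * v) with hc
  have key : ∀ x, gaussianPDFReal 0 s x * (gaussianPDFReal 0 v x / gaussianPDFReal 0 s x) ^ 2 =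
      c * gaussianPDFReal 0 w x := by
    intro x
    have hexp : Real.exp (-(x - 0) ^ 2 / (2 * v)) ^ 2 =
        Real.exp (-(x - 0) ^ 2 / (2 * w)) * Real.exp (-(x - 0) ^ 2 / (2 * s)) := by
      rw [← Real.exp_nat_mul, ← Real.exp_add, hwv, hv]
      congr 1
      field_simp
      ring
    have hsv : √(2 * Real.pi * v) ^ 2 = 2 * Real.pi * v := Real.sq_sqrt (by positivity)
    have h1 : 0 < √(2 * Real.pi * v) := by positivity
    have h2 : 0 < √(2 * Real.pi * s) := by positivity
    have h3 : 0 < √(2 * Real.pi * w) := by positivity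
    have h := gaussianPDFReal_pos 0 s x hs
    rw [div_pow, sq (gaussianPDFReal 0 s x), mul_div_assoc', mul_div_mul_left _ _ h.ne',
      div_eq_iff h.ne']
    simp only [gaussianPDFReal_def]
    rw [mul_pow, hexp, inv_pow, hsv, hc]
    field_simp
  have hcl : c ≤ Real.exp (l ^ 2) := by
    have h1 : c ^ 2 = ((1 + l) * (1 - l))⁻¹ := by
      rw [hc, div_pow, mul_pow, Real.sq_sqrt (by positivity), Real.sq_sqrt (by positivity), hwv, hv]
      field_simp
    have h2 : ((1 + l) * (1 - l))⁻¹ ≤ Real.exp (l ^ 2) ^ 2 := by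
      rw [← Real.exp_nat_mul]
      refine le_trans ?_ (Real.add_one_le_exp _)
      rw [inv_le_iff_one_le_mul₀ (by positivity)]
      have : l ^ 2 ≤ 1 / 4 := by nlinarith
      push_cast
      nlinarith [sq_nonneg l]
    exact le_of_sq_le_sq (h1 ▸ h2) (Real.exp_pos _).le
  rw [gaussianReal_of_var_ne_zero 0 hs, lintegral_withDensity_eq_lintegral_mul _
    (measurable_gaussianPDF 0 s) ((measurable_gaussianRatio s v).pow_const 2)]
  calc ∫⁻ x, (gaussianPDF 0 s * fun x => gaussianRatio s v x ^ 2) x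
      = ∫⁻ x, ENNReal.ofReal c * gaussianPDF 0 w x := by
        refine lintegral_congr fun x => ?_
        have h := gaussianPDFReal_pos 0 s x hs
        rw [Pi.mul_apply, gaussianRatio, gaussianPDF, gaussianPDF,
          ← ENNReal.ofReal_pow (by have := gaussianPDFReal_nonneg 0 v x; positivity),
          ← ENNReal.ofReal_mul h.le, key, ENNReal.ofReal_mul (by positivity)]
    _ = ENNReal.ofReal c := by
        rw [lintegral_const_mul _ (measurable_gaussianPDF 0 w), lintegral_gaussianPDF_eq_one 0 hwne,
          mul_one]
    _ ≤ _ := ENNReal.ofReal_le_ofReal hcl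

/-- Chi-square comparison of two centered Gaussian product measures. -/
lemma pi_gaussian_sq_le {ι : Type*} [Fintype ι] {s : NNReal} (hs : s ≠ 0) {l : ι → ℝ}
    (hl : ∀ i, |l i| ≤ 1 / 2) {v : ι → NNReal} (hv : ∀ i, (v i : ℝ) = s * (1 + l i))
    {A : Set (ι → ℝ)} (hA : MeasurableSet A) :
    (Measure.pi (fun i => gaussianReal 0 (v i)) A) ^ 2 ≤
      ENNReal.ofReal (Real.exp (∑ i, l i ^ 2)) * Measure.pi (fun _ => gaussianReal 0 s) A := by
  have hv0 : ∀ i, v i ≠ 0 := fun i h => by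
    have h1 := hv i
    have h2 := (abs_le.mp (hl i)).1
    have : (0 : ℝ) < s * (1 + l i) := mul_pos (by positivity) (by linarith)
    simp [← h1, h] at this
  rw [pi_withDensity_eq (fun i => measurable_gaussianRatio s (v i))
    (fun i => gaussianReal_eq_withDensity hs (hv0 i))]
  have hm : ∀ i, Measurable fun x => gaussianRatio s (v i) x ^ 2 :=
    fun i => (measurable_gaussianRatio s (v i)).pow_const 2
  refine (withDensity_sq_le _ (Finset.measurable_prod _ fun i _ =>
    (measurable_gaussianRatio s (v i)).comp (measurable_pi_apply i)) hA).trans ?_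
  gcongr
  simp_rw [← Finset.prod_pow, Function.comp_apply]
  rw [lintegral_prod_eq_prod_lintegral_of_indepFun Finset.univ
      (fun i (x : ι → ℝ) => gaussianRatio s (v i) (x i) ^ 2)
      (iIndepFun_pi (X := fun i x => gaussianRatio s (v i) x ^ 2) fun i => (hm i).aemeasurable)
      (fun i => (hm i).comp (measurable_pi_apply i)),
    Real.exp_sum, ENNReal.ofReal_prod_of_nonneg fun i _ => (Real.exp_pos _).le]
  refine Finset.prod_le_prod' fun i _ => ?_
  rw [(measurePreserving_eval (fun _ : ι => gaussianReal 0 s) i).lintegral_comp (hm i)]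
  exact lintegral_gaussianRatio_sq_le hs (hl i) (hv i)

/-- A linear functional of independent centered Gaussians is a centered Gaussian. -/
lemma map_pi_gaussian_linear {ι : Type*} [Fintype ι] (v : ι → NNReal) (c : ι → ℝ) :
    Measure.map (fun y : ι → ℝ => ∑ i, c i * y i) (Measure.pi fun i => gaussianReal 0 (v i)) =
      gaussianReal 0 (∑ i, c i ^ 2 * (v i : ℝ)).toNNReal := by
  have hmeas : Measurable fun y : ι → ℝ => ∑ i, c i * y i := by fun_prop
  have := Measure.isProbabilityMeasure_map (μ := Measure.pi fun i => gaussianReal 0 (v i))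
    hmeas.aemeasurable
  refine Measure.ext_of_charFun (funext fun t => ?_)
  rw [charFun_gaussianReal, charFun_apply_real, integral_map hmeas.aemeasurable (by fun_prop)]
  have h1 : ∀ y : ι → ℝ, Complex.exp (t * (∑ i, c i * y i : ℝ) * Complex.I) =
      ∏ i, Complex.exp ((t * c i : ℝ) * y i * Complex.I) := by
    intro y
    rw [← Complex.exp_sum]
    congr 1
    push_cast
    rw [Finset.mul_sum, Finset.sum_mul]
    exact Finset.sum_congr rfl fun i _ => by ring
  simp_rw [h1]
  rw [integral_fintype_prod_eq_prod (fun i (x : ℝ) => Complex.exp ((t * c i : ℝ) * x * Complex.I))]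
  simp_rw [← charFun_apply_real, charFun_gaussianReal]
  rw [← Complex.exp_sum, Real.coe_toNNReal _ (by positivity)]
  congr 1
  push_cast
  rw [mul_zero, zero_mul, zero_sub, Finset.sum_mul, Finset.sum_div, ← Finset.sum_neg_distrib]
  exact Finset.sum_congr rfl fun i _ => by ring

/-- Diagonalisation of a real symmetric matrix, in coordinates. -/
lemma exists_orthogonal_diagonalization {ι : Type*} [Fintype ι] {G : Matrix ι ι ℝ}
    (hG : ∀ i j, G i j = G j i) :
    ∃ (U : Matrix ι ι ℝ) (l : ι → ℝ),
      (∀ x : ι → ℝ, ∑ k, (∑ i, x i * U i k) ^ 2 = ∑ i, x i ^ 2) ∧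
      (∀ x : ι → ℝ, ∑ i, ∑ j, x i * G i j * x j = ∑ k, (∑ i, x i * U i k) ^ 2 * l k) ∧
      (∑ k, l k ^ 2 = ∑ i, ∑ j, G i j ^ 2) ∧
      ∀ R, (∀ x : ι → ℝ, |∑ i, ∑ j, x i * G i j * x j| ≤ R * ∑ i, x i ^ 2) → ∀ k, |l k| ≤ R := by
  have hH : G.IsHermitian := Matrix.IsHermitian.ext fun i j => by simp [hG i j]
  set U : Matrix ι ι ℝ := hH.eigenvectorUnitary.1
  set l := hH.eigenvalues
  have hUU : U * U.transpose = 1 := by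
    have := Unitary.coe_mul_star_self hH.eigenvectorUnitary
    rwa [Unitary.coe_star, Matrix.star_eq_conjTranspose, Matrix.conjTranspose_eq_transpose_of_trivial] at this
  have hUU' : U.transpose * U = 1 := mul_eq_one_comm.mp hUU
  have hspec : G = U * Matrix.diagonal l * U.transpose := by
    have := hH.spectral_theorem
    rw [Unitary.conjStarAlgAut_apply, Matrix.star_eq_conjTranspose,
      Matrix.conjTranspose_eq_transpose_of_trivial] at this
    simpa using! this
  have hvec : ∀ (x : ι → ℝ) k, ∑ i, x i * U i k = Matrix.vecMul x U k := fun x k => rfl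
  have hform : ∀ (x : ι → ℝ) (M : Matrix ι ι ℝ), ∑ i, ∑ j, x i * M i j * x j =
      x ⬝ᵥ M.mulVec x := fun x M => by
    simp [dotProduct, Matrix.mulVec, Finset.mul_sum, mul_assoc]
  have hnorm : ∀ x : ι → ℝ, ∑ k, (∑ i, x i * U i k) ^ 2 = ∑ i, x i ^ 2 := by
    intro x
    simp_rw [hvec, sq]
    change Matrix.vecMul x U ⬝ᵥ Matrix.vecMul x U = x ⬝ᵥ x
    rw [← Matrix.mulVec_transpose, Matrix.dotProduct_mulVec, Matrix.vecMul_transpose,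
      Matrix.mulVec_mulVec, hUU, Matrix.one_mulVec]
  have hquad : ∀ x : ι → ℝ, ∑ i, ∑ j, x i * G i j * x j =
      ∑ k, (∑ i, x i * U i k) ^ 2 * l k := by
    intro x
    rw [hform, hspec, ← Matrix.mulVec_mulVec, ← Matrix.mulVec_mulVec, Matrix.dotProduct_mulVec,
      Matrix.mulVec_transpose]
    simp_rw [hvec, dotProduct, Matrix.mulVec_diagonal]
    exact Finset.sum_congr rfl fun k _ => by ring
  refine ⟨U, l, hnorm, hquad, ?_, ?_⟩
  · have h1 : ∑ i, ∑ j, G i j ^ 2 = (G * G).trace := by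
      simp only [Matrix.trace, Matrix.diag, Matrix.mul_apply]
      exact Finset.sum_congr rfl fun i _ => Finset.sum_congr rfl fun j _ => by rw [hG j i, sq]
    have h2 : G * G = U * (Matrix.diagonal l * Matrix.diagonal l) * U.transpose := by
      calc G * G = U * Matrix.diagonal l * (U.transpose * U) * Matrix.diagonal l * U.transpose := by
            conv_lhs => rw [hspec]
            simp only [Matrix.mul_assoc]
        _ = _ := by rw [hUU', Matrix.mul_one, Matrix.mul_assoc U]
    rw [h1, h2, Matrix.trace_mul_comm, ← Matrix.mul_assoc, hUU', Matrix.one_mul,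
      Matrix.diagonal_mul_diagonal, Matrix.trace_diagonal]
    exact Finset.sum_congr rfl fun k _ => sq _
  · intro R hR k
    have h := hR (fun i => U i k)
    have hort : ∀ m, ∑ i, U i k * U i m = if k = m then 1 else 0 := fun m => by
      simpa [Matrix.mul_apply, Matrix.one_apply] using congrFun (congrFun hUU' k) m
    rw [hquad] at h
    simp_rw [hort] at h
    have h1 := hort k
    simp only [← sq, if_true] at h1
    simpa [h1] using h

lemma isCenteredGaussianCov_map {ι : Type*} [Fintype ι] (U : Matrix ι ι ℝ) (v : ι → NNReal)
    (S : Matrix ι ι ℝ)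
    (hS : ∀ x : ι → ℝ, ∑ i, ∑ j, x i * S i j * x j = ∑ k, (∑ i, x i * U i k) ^ 2 * (v k : ℝ)) :
    IsCenteredGaussianCov ((Measure.pi fun i => gaussianReal 0 (v i)).map U.mulVec) S := by
  have hU : Measurable (U.mulVec : (ι → ℝ) → ι → ℝ) := by
    unfold Matrix.mulVec dotProduct
    fun_prop
  refine ⟨Measure.isProbabilityMeasure_map hU.aemeasurable, fun x => ?_⟩
  rw [Measure.map_map (by fun_prop) hU, hS, ← map_pi_gaussian_linear]
  congr 1
  ext y
  simp only [Function.comp_apply, Matrix.mulVec, dotProduct, Finset.mul_sum, Finset.sum_mul]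
  rw [Finset.sum_comm]
  exact Finset.sum_congr rfl fun i _ => Finset.sum_congr rfl fun k _ => by ring

/-- White noise with variance `s` and its perturbation by a small symmetric matrix `G` are the laws
of a pair of measures that are comparable through the Frobenius norm of `G`. -/
lemma exists_gaussian_pair {ι : Type*} [Fintype ι] [DecidableEq ι] {s : ℝ} (hs : 0 < s) {G : Matrix ι ι ℝ}
    (hG : ∀ i j, G i j = G j i) {K : ℝ}
    (hR : ∀ x : ι → ℝ, |∑ i, ∑ j, x i * G i j * x j| ≤ s / 2 * ∑ i, x i ^ 2)
    (hK : ∑ i, ∑ j, G i j ^ 2 ≤ K * s ^ 2) :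
    ∃ P₀ P₁ : Measure (ι → ℝ),
      IsCenteredGaussianCov P₀ (Matrix.of fun i j => if i = j then s else 0) ∧
      IsCenteredGaussianCov P₁ (Matrix.of fun i j => (if i = j then s else 0) + G i j) ∧
      ∀ A, MeasurableSet A → (P₁ A).toReal ^ 2 ≤ Real.exp K * (P₀ A).toReal := by
  obtain ⟨U, l, hnorm, hquad, hsq, hbound⟩ := exists_orthogonal_diagonalization hG
  have hl := hbound _ hR
  have hv : ∀ k, 0 ≤ s + l k := fun k => by linarith [(abs_le.mp (hl k)).1]
  have hdiag : ∀ x : ι → ℝ, ∑ i, ∑ j, x i * (if i = j then s else 0) * x j =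
      ∑ k, (∑ i, x i * U i k) ^ 2 * s := fun x => by
    rw [← Finset.sum_mul, hnorm, Finset.sum_mul]
    exact Finset.sum_congr rfl fun i _ => by simp; ring
  have hU : Measurable (U.mulVec : (ι → ℝ) → ι → ℝ) := by
    unfold Matrix.mulVec dotProduct
    fun_prop
  set s' : NNReal := ⟨s, hs.le⟩
  set v : ι → NNReal := fun k => ⟨s + l k, hv k⟩
  have hs_coe : (s' : ℝ) = s := rfl
  have hvc : ∀ k, (v k : ℝ) = s + l k := fun _ => rfl
  have hs' : s' ≠ 0 := fun h => hs.ne' (congrArg NNReal.toReal h)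
  refine ⟨(Measure.pi fun _ => gaussianReal 0 s').map U.mulVec,
    (Measure.pi fun i => gaussianReal 0 (v i)).map U.mulVec,
    isCenteredGaussianCov_map U _ _ hdiag, isCenteredGaussianCov_map U _ _ fun x => ?_,
    fun A hA => ?_⟩
  · calc ∑ i, ∑ j, x i * ((if i = j then s else 0) + G i j) * x j
        = ∑ i, ∑ j, x i * (if i = j then s else 0) * x j + ∑ i, ∑ j, x i * G i j * x j := by
          simp_rw [← Finset.sum_add_distrib]
          exact Finset.sum_congr rfl fun i _ => Finset.sum_congr rfl fun j _ => by ring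
      _ = ∑ k, (∑ i, x i * U i k) ^ 2 * (v k : ℝ) := by
          rw [hdiag, hquad, ← Finset.sum_add_distrib]
          exact Finset.sum_congr rfl fun k _ => by rw [hvc]; ring
  · rw [Measure.map_apply hU hA, Measure.map_apply hU hA]
    have h := pi_gaussian_sq_le hs' (l := fun k => l k / s) (v := v)
      (fun k => by rw [abs_div, abs_of_pos hs, div_le_iff₀ hs]; linarith [hl k])
      (fun k => by rw [hvc, hs_coe]; field_simp) (hU hA)
    have h2 := ENNReal.toReal_mono (by finiteness) h
    rw [ENNReal.toReal_pow, ENNReal.toReal_mul, ENNReal.toReal_ofReal (Real.exp_pos _).le] at h2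
    refine h2.trans ?_
    gcongr
    simp_rw [div_pow]
    rw [← Finset.sum_div, hsq, div_le_iff₀ (by positivity)]
    exact hK

/-- Two-point lower bound for the probability of a large error. -/
lemma two_point_bound {Ω : Type*} [MeasurableSpace Ω] {P₀ P₁ : Measure Ω}
    [IsProbabilityMeasure P₀] [IsProbabilityMeasure P₁] {M : ℝ} (hM : 1 ≤ M)
    (hP : ∀ A, MeasurableSet A → (P₁ A).toReal ^ 2 ≤ M * (P₀ A).toReal)
    {f : Ω → ℝ} (hf : Measurable f) {a b δ : ℝ} (hab : 2 * δ ≤ |b - a|) :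
    (4 * M)⁻¹ ≤ (P₀ {x | δ ≤ |f x - a|}).toReal ∨ (4 * M)⁻¹ ≤ (P₁ {x | δ ≤ |f x - b|}).toReal := by
  have hA : MeasurableSet {x | δ ≤ |f x - a|} :=
    measurableSet_le measurable_const (hf.sub_const a).abs
  by_cases h : 1 / 2 ≤ (P₁ {x | δ ≤ |f x - b|}).toReal
  · right
    refine le_trans ?_ h
    rw [inv_le_comm₀ (by positivity) (by norm_num)]
    linarith
  · left
    have hcover : (1 : ℝ) ≤ (P₁ {x | δ ≤ |f x - a|}).toReal + (P₁ {x | δ ≤ |f x - b|}).toReal := by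
      have hun : {x | δ ≤ |f x - a|} ∪ {x | δ ≤ |f x - b|} = Set.univ := by
        refine Set.eq_univ_of_forall fun x => ?_
        by_contra hx
        simp only [Set.mem_union, Set.mem_ofPred_eq, not_or, not_le] at hx
        have := abs_sub_le b (f x) a
        rw [abs_sub_comm b (f x)] at this
        linarith
      have := measureReal_union_le (μ := P₁) {x | δ ≤ |f x - a|} {x | δ ≤ |f x - b|}
      rw [hun, probReal_univ] at this
      exact this
    have h2 := hP _ hA
    rw [inv_le_iff_one_le_mul₀ (by positivity)]
    nlinarith

/-- Schur's test for a symmetric kernel with bounded absolute row sums. -/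
lemma abs_quadForm_le {ι : Type*} (F : Finset ι) {A : ι → ι → ℝ} (hA : ∀ i j, A i j = A j i)
    {R : ℝ} (hR : ∀ j ∈ F, ∑ k ∈ F, |A j k| ≤ R) (x : ι → ℝ) :
    |∑ j ∈ F, ∑ k ∈ F, x j * A j k * x k| ≤ R * ∑ j ∈ F, x j ^ 2 := by
  have hsum : ∑ j ∈ F, ∑ k ∈ F, |A j k| * x j ^ 2 ≤ R * ∑ j ∈ F, x j ^ 2 := by
    rw [Finset.mul_sum]
    refine Finset.sum_le_sum fun j hj => ?_
    rw [← Finset.sum_mul]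
    exact mul_le_mul_of_nonneg_right (hR j hj) (sq_nonneg _)
  have hswap : ∑ j ∈ F, ∑ k ∈ F, |A j k| * x k ^ 2 = ∑ j ∈ F, ∑ k ∈ F, |A j k| * x j ^ 2 := by
    rw [Finset.sum_comm]
    exact Finset.sum_congr rfl fun j _ => Finset.sum_congr rfl fun k _ => by rw [hA]
  calc |∑ j ∈ F, ∑ k ∈ F, x j * A j k * x k|
      ≤ ∑ j ∈ F, ∑ k ∈ F, |x j * A j k * x k| :=
        (Finset.abs_sum_le_sum_abs _ _).trans
          (Finset.sum_le_sum fun j _ => Finset.abs_sum_le_sum_abs _ _)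
    _ ≤ ∑ j ∈ F, ∑ k ∈ F, (|A j k| * x j ^ 2 + |A j k| * x k ^ 2) / 2 := by
        refine Finset.sum_le_sum fun j _ => Finset.sum_le_sum fun k _ => ?_
        rw [abs_mul, abs_mul, ← sq_abs (x j), ← sq_abs (x k)]
        nlinarith [mul_nonneg (abs_nonneg (A j k)) (sq_nonneg (|x j| - |x k|))]
    _ = ∑ j ∈ F, ∑ k ∈ F, |A j k| * x j ^ 2 := by
        simp_rw [← Finset.sum_div, Finset.sum_add_distrib]
        rw [hswap, add_self_div_two]
    _ ≤ _ := hsum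

/-- The box `{-N, …, N}^d`. -/
noncomputable def latticeBox (d N : ℕ) : Finset (Fin d → ℤ) :=
  Fintype.piFinset fun _ => Finset.Icc (-(N : ℤ)) N

lemma mem_latticeBox {d N : ℕ} {k : Fin d → ℤ} : k ∈ latticeBox d N ↔ ∀ i, |k i| ≤ N := by
  simp [latticeBox, abs_le]

lemma card_latticeBox (d N : ℕ) : ((latticeBox d N).card : ℝ) = (2 * N + 1) ^ d := by
  have h : ((N : ℤ) + 1 + N).toNat = 2 * N + 1 := by omega
  simp [latticeBox, h]

lemma neg_mem_latticeBox {d N : ℕ} {k : Fin d → ℤ} : -k ∈ latticeBox d N ↔ k ∈ latticeBox d N := by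
  simp [mem_latticeBox]

lemma zero_mem_latticeBox (d N : ℕ) : (0 : Fin d → ℤ) ∈ latticeBox d N := by
  simp [mem_latticeBox]

/-- The number `d * N` is a crude bound for the Euclidean norm on the box. -/
lemma znorm_le_of_mem_latticeBox {d N : ℕ} {k : Fin d → ℤ} (hk : k ∈ latticeBox d N) :
    znorm k ≤ (d : ℝ) * N := by
  refine Real.sqrt_le_iff.mpr ⟨by positivity, ?_⟩
  calc ∑ i, (k i : ℝ) ^ 2 ≤ ∑ _i : Fin d, (N : ℝ) ^ 2 := by
        refine Finset.sum_le_sum fun i _ => sq_le_sq' ?_ ?_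
        · exact_mod_cast (abs_le.mp (mem_latticeBox.mp hk i)).1
        · exact_mod_cast (abs_le.mp (mem_latticeBox.mp hk i)).2
    _ = d * (N : ℝ) ^ 2 := by simp
    _ ≤ (d * N) ^ 2 := by
        rw [mul_pow]
        gcongr
        exact_mod_cast Nat.le_self_pow two_ne_zero d

lemma sum_comp_le_of_support_latticeBox {ι : Type*} {d N : ℕ} {B : ℝ} (hB : 0 ≤ B)
    {q : (Fin d → ℤ) → ℝ} (hq : ∀ k, q k ≤ if k ∈ latticeBox d N then B else 0)
    (F : Finset ι) {φ : ι → Fin d → ℤ} (hφ : Function.Injective φ) :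
    ∑ k ∈ F, q (φ k) ≤ (2 * N + 1) ^ d * B := by
  calc ∑ k ∈ F, q (φ k) ≤ ∑ k ∈ F, if φ k ∈ latticeBox d N then B else 0 :=
        Finset.sum_le_sum fun k _ => hq _
    _ = ∑ k ∈ F.map ⟨φ, hφ⟩, if k ∈ latticeBox d N then B else 0 :=
        by rw [Finset.sum_map]; rfl
    _ = ((F.map ⟨φ, hφ⟩ ∩ latticeBox d N).card : ℝ) * B := by
        rw [← Finset.sum_filter, Finset.sum_const, nsmul_eq_mul, Finset.filter_mem_eq_inter]
    _ ≤ (latticeBox d N).card * B := by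
        gcongr
        exact Finset.inter_subset_right
    _ = _ := by rw [card_latticeBox]

/-- A cosine at frequency `θ`, truncated to a box. -/
noncomputable def cosBump {d : ℕ} (a : ℝ) (N : ℕ) (θ : Fin d → ℝ) (k : Fin d → ℤ) : ℝ :=
  if k ∈ latticeBox d N then a * Real.cos (∑ i, (k i : ℝ) * θ i) else 0

lemma cosBump_neg {d : ℕ} (a : ℝ) (N : ℕ) (θ : Fin d → ℝ) (k : Fin d → ℤ) :
    cosBump a N θ (-k) = cosBump a N θ k := by
  have : ∑ i, (((-k) i : ℤ) : ℝ) * θ i = -∑ i, (k i : ℝ) * θ i := by simp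
  simp only [cosBump, neg_mem_latticeBox, this, Real.cos_neg]

lemma cosBump_zero_left {d : ℕ} (N : ℕ) (θ : Fin d → ℝ) (k : Fin d → ℤ) :
    cosBump 0 N θ k = 0 := by
  simp [cosBump]

lemma abs_cosBump_le {d : ℕ} {a : ℝ} (ha : 0 ≤ a) (N : ℕ) (θ : Fin d → ℝ) (k : Fin d → ℤ) :
    |cosBump a N θ k| ≤ if k ∈ latticeBox d N then a else 0 := by
  unfold cosBump
  split_ifs
  · rw [abs_mul, abs_of_nonneg ha]
    exact mul_le_of_le_one_right ha (Real.abs_cos_le_one _)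
  · simp

lemma cosBump_sq_le {d : ℕ} {a : ℝ} (ha : 0 ≤ a) (N : ℕ) (θ : Fin d → ℝ) (k : Fin d → ℤ) :
    cosBump a N θ k ^ 2 ≤ if k ∈ latticeBox d N then a ^ 2 else 0 := by
  have h := pow_le_pow_left₀ (abs_nonneg _) (abs_cosBump_le ha N θ k) 2
  rwa [sq_abs, ite_pow, zero_pow two_ne_zero] at h

/-- White noise of variance `s` plus a truncated cosine. -/
noncomputable def bumpCov {d : ℕ} (s a : ℝ) (N : ℕ) (θ : Fin d → ℝ) (k : Fin d → ℤ) : ℝ :=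
  (if k = 0 then s else 0) + cosBump a N θ k

lemma bumpCov_of_notMem {d : ℕ} (s a : ℝ) {N : ℕ} (θ : Fin d → ℝ) {k : Fin d → ℤ}
    (hk : k ∉ latticeBox d N) : bumpCov s a N θ k = 0 := by
  have h0 : k ≠ 0 := fun h => hk (h ▸ zero_mem_latticeBox d N)
  simp [bumpCov, cosBump, hk, h0]

lemma abs_quadForm_cosBump_le {ι : Type*} {d : ℕ} {s a : ℝ} (ha : 0 ≤ a) {N : ℕ}
    (has : (2 * N + 1) ^ d * a ≤ s / 2) (θ : Fin d → ℝ) (F : Finset ι)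
    {φ : ι → ι → Fin d → ℤ} (hneg : ∀ i j, φ j i = -φ i j)
    (hφ : ∀ j, Function.Injective (φ j)) (x : ι → ℝ) :
    |∑ j ∈ F, ∑ k ∈ F, x j * cosBump a N θ (φ j k) * x k| ≤ s / 2 * ∑ j ∈ F, x j ^ 2 :=
  abs_quadForm_le F (A := fun j k => cosBump a N θ (φ j k))
    (fun i j => by rw [hneg i j, cosBump_neg])
    (fun j _ => (sum_comp_le_of_support_latticeBox ha (q := fun k => |cosBump a N θ k|)
      (abs_cosBump_le ha N θ) F (hφ j)).trans has) x

lemma PLD_bumpCov {d : ℕ} {β s a : ℝ} (hβ : 0 < β) (ha : 0 ≤ a) {N : ℕ}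
    (has : a * ((1 + ((d : ℝ) * N) ^ β) * (2 * N + 1) ^ d) ≤ s / 2) (θ : Fin d → ℝ) :
    PLD d β (2 * s) (bumpCov s a N θ) := by
  have hRβ : 0 ≤ ((d : ℝ) * N) ^ β := by positivity
  have hs : 0 ≤ s := by
    have : 0 ≤ a * ((1 + ((d : ℝ) * N) ^ β) * (2 * N + 1) ^ d) := by positivity
    linarith
  have hsupp : ∀ k ∉ latticeBox d N, (1 + znorm k ^ β) * |bumpCov s a N θ k| = 0 :=
    fun k hk => by rw [bumpCov_of_notMem s a θ hk, abs_zero, mul_zero]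
  refine ⟨fun k => ?_, summable_of_ne_finset_zero hsupp, ?_, fun F x => ?_⟩
  · simp only [bumpCov, cosBump_neg, neg_eq_zero]
  · rw [tsum_eq_sum hsupp]
    calc ∑ k ∈ latticeBox d N, (1 + znorm k ^ β) * |bumpCov s a N θ k|
        ≤ ∑ k ∈ latticeBox d N, ((if k = 0 then s else 0) + (1 + ((d : ℝ) * N) ^ β) * a) := by
          refine Finset.sum_le_sum fun k hk => ?_
          have hz : (0 : ℝ) ≤ znorm k := Real.sqrt_nonneg _
          have hzR : znorm k ^ β ≤ ((d : ℝ) * N) ^ β :=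
            Real.rpow_le_rpow hz (znorm_le_of_mem_latticeBox hk) hβ.le
          have hb := abs_cosBump_le ha N θ k
          rw [if_pos hk] at hb
          have hb' : (1 + znorm k ^ β) * |cosBump a N θ k| ≤ (1 + ((d : ℝ) * N) ^ β) * a := by
            gcongr
          refine le_trans ?_ (add_le_add_right hb' _)
          unfold bumpCov
          by_cases h0 : k = 0
          · have hz0 : znorm k ^ β = 0 := by
              simp [h0, znorm, Real.zero_rpow hβ.ne']
            rw [hz0, if_pos h0]
            have := abs_add_le s (cosBump a N θ k)
            rw [abs_of_nonneg hs] at this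
            linarith
          · simp [h0]
      _ = s + (2 * N + 1) ^ d * ((1 + ((d : ℝ) * N) ^ β) * a) := by
          rw [Finset.sum_add_distrib, Finset.sum_const, nsmul_eq_mul, card_latticeBox,
            Finset.sum_ite_eq' _ _ fun _ => s, if_pos (zero_mem_latticeBox d N)]
      _ ≤ 2 * s := by nlinarith
  · have has' : (2 * N + 1) ^ d * a ≤ s / 2 := by
      have : 0 ≤ a * (((d : ℝ) * N) ^ β * (2 * N + 1) ^ d) := by positivity
      nlinarith
    have hform := abs_quadForm_cosBump_le ha has' θ F (φ := fun j k => j - k)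
      (fun i j => (neg_sub i j).symm) (fun j => sub_right_injective) x
    have hx : 0 ≤ ∑ j ∈ F, x j ^ 2 := by positivity
    have heq : ∑ j ∈ F, ∑ k ∈ F, x j * bumpCov s a N θ (j - k) * x k =
        s * ∑ j ∈ F, x j ^ 2 + ∑ j ∈ F, ∑ k ∈ F, x j * cosBump a N θ (j - k) * x k := by
      rw [Finset.mul_sum, ← Finset.sum_add_distrib]
      refine Finset.sum_congr rfl fun j hj => ?_
      simp_rw [bumpCov, mul_add, add_mul, Finset.sum_add_distrib, sub_eq_zero]
      congr 1
      simp only [mul_ite, ite_mul, mul_zero, zero_mul, Finset.sum_ite_eq, if_pos hj]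
      ring
    rw [heq]
    have := (abs_le.mp hform).1
    nlinarith

lemma specVal_bumpCov {d : ℕ} (s a : ℝ) (N : ℕ) (θ : Fin d → ℝ) :
    specVal d (bumpCov s a N θ) θ = ((2 * Real.pi) ^ d)⁻¹ *
      (s + a * ∑ k ∈ latticeBox d N, Real.cos (∑ i, (k i : ℝ) * θ i) ^ 2) := by
  unfold specVal
  rw [tsum_eq_sum (s := latticeBox d N) fun k hk => by
    rw [bumpCov_of_notMem s a θ hk, Complex.ofReal_zero, zero_mul], Complex.re_sum]
  congr 1
  calc _ = ∑ k ∈ latticeBox d N, ((if k = 0 then s else 0) +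
          a * Real.cos (∑ i, (k i : ℝ) * θ i) ^ 2) := by
        refine Finset.sum_congr rfl fun k hk => ?_
        have h1 : Complex.exp (Complex.I * ∑ i, ((k i : ℝ) : ℂ) * (θ i : ℂ)) =
            Complex.exp ((∑ i, (k i : ℝ) * θ i : ℝ) * Complex.I) := by
          push_cast
          rw [mul_comm]
        simp only [Complex.ofReal_mul, Complex.ofReal_sum] at h1 ⊢
        rw [h1, Complex.re_ofReal_mul]
        have h2 := Complex.exp_ofReal_mul_I_re (∑ i, (k i : ℝ) * θ i)
        simp only [Complex.ofReal_mul, Complex.ofReal_sum] at h2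
        rw [h2, bumpCov, cosBump, if_pos hk]
        by_cases h0 : k = 0
        · simp [h0]
        · simp [h0]; ring
    _ = _ := by
        rw [Finset.sum_add_distrib, Finset.sum_ite_eq' _ _ fun _ => s,
          if_pos (zero_mem_latticeBox d N), Finset.mul_sum]

/-- Doubling the frequency shows that a cosine cannot be small on most of a box. -/
lemma sum_cos_sq_ge {d : ℕ} (m : ℕ) (θ : Fin d → ℝ) :
    (2 * (m : ℝ) + 1) ^ d / 8 ≤
      ∑ k ∈ latticeBox d (2 * m), Real.cos (∑ i, (k i : ℝ) * θ i) ^ 2 := by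
  have h1 : ∑ k ∈ latticeBox d m, Real.cos (∑ i, (k i : ℝ) * θ i) ^ 2 ≤
      ∑ k ∈ latticeBox d (2 * m), Real.cos (∑ i, (k i : ℝ) * θ i) ^ 2 := by
    refine Finset.sum_le_sum_of_subset_of_nonneg (fun k hk => ?_) fun _ _ _ => sq_nonneg _
    rw [mem_latticeBox] at hk ⊢
    intro i
    have := hk i
    push_cast
    omega
  have h2 : ∑ k ∈ latticeBox d m, Real.cos (2 * ∑ i, (k i : ℝ) * θ i) ^ 2 ≤
      ∑ k ∈ latticeBox d (2 * m), Real.cos (∑ i, (k i : ℝ) * θ i) ^ 2 := by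
    have hinj : Function.Injective fun k : Fin d → ℤ => 2 • k :=
      smul_right_injective _ two_ne_zero
    calc _ = ∑ k ∈ (latticeBox d m).image (fun k => 2 • k),
          Real.cos (∑ i, (k i : ℝ) * θ i) ^ 2 := by
          rw [Finset.sum_image fun x _ y _ h => hinj h]
          refine Finset.sum_congr rfl fun k _ => ?_
          rw [Finset.mul_sum]
          congr 2
          refine Finset.sum_congr rfl fun i _ => ?_
          simp
          ring
      _ ≤ _ := by
          refine Finset.sum_le_sum_of_subset_of_nonneg (fun k hk => ?_) fun _ _ _ => sq_nonneg _
          obtain ⟨k, hkm, rfl⟩ := Finset.mem_image.mp hk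
          clear hk
          rw [mem_latticeBox] at hkm ⊢
          intro i
          have := hkm i
          simp [abs_mul]
          omega
  have h3 : (2 * (m : ℝ) + 1) ^ d * (1 / 4) ≤ ∑ k ∈ latticeBox d m,
      (Real.cos (∑ i, (k i : ℝ) * θ i) ^ 2 + Real.cos (2 * ∑ i, (k i : ℝ) * θ i) ^ 2) := by
    rw [← card_latticeBox, ← nsmul_eq_mul]
    refine Finset.card_nsmul_le_sum _ _ _ fun k _ => ?_
    rw [Real.cos_two_mul]
    nlinarith [sq_nonneg (Real.cos (∑ i, (k i : ℝ) * θ i) ^ 2 - 3 / 8)]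
  rw [Finset.sum_add_distrib] at h3
  linarith

/-- Even integers of order `n ^ ρ` with prescribed proportionality constant. -/
lemma eventually_exists_even_near_rpow {ε ρ : ℝ} (hε : 0 < ε) (hρ : 0 < ρ) :
    ∀ᶠ n : ℕ in atTop, ∃ m : ℕ, 1 ≤ m ∧ ε / 2 * (n : ℝ) ^ ρ ≤ ((2 * m : ℕ) : ℝ) ∧
      ((2 * m : ℕ) : ℝ) ≤ ε * (n : ℝ) ^ ρ := by
  have ht := ((tendsto_rpow_atTop hρ).comp tendsto_natCast_atTop_atTop).eventually_ge_atTop (4 / ε)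
  filter_upwards [ht] with n hn
  rw [Function.comp_apply, div_le_iff₀ hε] at hn
  set t : ℝ := ε * (n : ℝ) ^ ρ / 2 with ht
  have hle := Nat.floor_le (a := t) (by positivity)
  have hlt := Nat.lt_floor_add_one t
  refine ⟨⌊t⌋₊, ?_, ?_, ?_⟩
  · rw [Nat.one_le_floor_iff]
    linarith
  all_goals push_cast; linarith

/-- Both hypotheses lie in the class and generate comparable Gaussian observations, so no estimator
separates them. -/
lemma exists_large_error {d n N : ℕ} {β s a K δ : ℝ} {θ : Fin d → ℝ} (hβ : 0 < β) (hs : 0 < s)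
    (ha : 0 ≤ a) (hK : 0 ≤ K)
    (has : a * ((1 + ((d : ℝ) * N) ^ β) * (2 * N + 1) ^ d) ≤ s / 2)
    (haK : (n : ℝ) ^ d * ((2 * N + 1) ^ d * a ^ 2) ≤ K * s ^ 2)
    (hδ : 2 * δ ≤ |specVal d (bumpCov s a N θ) θ - specVal d (bumpCov s 0 N θ) θ|)
    {f : ((Fin d → Fin n) → ℝ) → ℝ} (hf : Measurable f) :
    ∃ C, PLD d β (2 * s) C ∧ ∃ P : Measure ((Fin d → Fin n) → ℝ),
      IsCenteredGaussianCov P (Matrix.of fun j k : Fin d → Fin n =>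
        C fun i => (j i : ℤ) - (k i : ℤ)) ∧
      (4 * Real.exp K)⁻¹ ≤ (P {x | δ ≤ |f x - specVal d C θ|}).toReal := by
  set φ : (Fin d → Fin n) → (Fin d → Fin n) → Fin d → ℤ :=
    fun j k i => (j i : ℤ) - (k i : ℤ)
  have hneg : ∀ j k, φ k j = -φ j k := fun j k => by
    ext i
    simp [φ]
  have hinj : ∀ j, Function.Injective (φ j) := fun j k k' h => by
    ext i
    have := congrFun h i
    simp only [φ] at this
    omega
  have hzero : ∀ j k, φ j k = 0 ↔ j = k := fun j k => by
    have : φ j j = 0 := by ext i; simp [φ]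
    rw [eq_comm (a := j), ← (hinj j).eq_iff, this]
  have hcov : ∀ b, (Matrix.of fun j k : Fin d → Fin n => bumpCov s b N θ (φ j k)) =
      Matrix.of fun j k => (if j = k then s else 0) + cosBump b N θ (φ j k) := fun b => by
    ext j k
    simp only [Matrix.of_apply, bumpCov, hzero]
  have has' : (2 * (N : ℝ) + 1) ^ d * a ≤ s / 2 := by
    have : 0 ≤ a * (((d : ℝ) * N) ^ β * (2 * N + 1) ^ d) := by positivity
    nlinarith
  obtain ⟨P₀, P₁, h₀, h₁, hP⟩ := exists_gaussian_pair hs (K := K)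
    (G := fun j k => cosBump a N θ (φ j k)) (fun j k => by rw [hneg j k, cosBump_neg])
    (abs_quadForm_cosBump_le ha has' θ Finset.univ hneg hinj) (by
      refine le_trans ?_ haK
      calc ∑ j, ∑ k, cosBump a N θ (φ j k) ^ 2
          ≤ ∑ _j : Fin d → Fin n, (2 * (N : ℝ) + 1) ^ d * a ^ 2 :=
            Finset.sum_le_sum fun j _ => sum_comp_le_of_support_latticeBox (sq_nonneg a)
              (q := fun k => cosBump a N θ k ^ 2) (cosBump_sq_le ha N θ) _ (hinj j)
        _ = _ := by simp)
  have := h₀.1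
  have := h₁.1
  rcases two_point_bound (Real.one_le_exp hK) hP hf hδ with h | h
  · refine ⟨_, PLD_bumpCov hβ le_rfl (by rw [zero_mul]; positivity) θ, P₀, ?_, h⟩
    rw [hcov]
    simpa only [cosBump_zero_left, add_zero] using h₀
  · exact ⟨_, PLD_bumpCov hβ ha has θ, P₁, by rw [hcov]; exact h₁, h⟩

/-- A uniform lower bound for the worst-case error probability of every estimator. -/
lemma eventually_forall_exists_large_error {d : ℕ} (hd : 1 ≤ d) {β L : ℝ} (hβ : 0 < β) (hL : 0 < L)
    (θ : Fin d → ℝ) :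
    ∃ c > 0, ∀ᶠ n : ℕ in atTop, ∀ f : ((Fin d → Fin n) → ℝ) → ℝ, Measurable f →
      ∃ C, PLD d β L C ∧ ∃ P : Measure ((Fin d → Fin n) → ℝ),
        IsCenteredGaussianCov P (Matrix.of fun j k : Fin d → Fin n =>
          C fun i => (j i : ℤ) - (k i : ℤ)) ∧
        c ≤ (P {x | (n : ℝ) ^ (-((d : ℝ) * β) / (2 * β + d)) ≤ |f x - specVal d C θ|}).toReal := by
  have hd0 : (0 : ℝ) < d := by exact_mod_cast hd
  set ρ : ℝ := d / (2 * β + d) with hρdef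
  have hρ : 0 < ρ := by positivity
  set c₂ : ℝ := ((2 * Real.pi) ^ d)⁻¹ * L / (64 * 2 ^ d * (d : ℝ) ^ β) with hc₂def
  have hc₂ : 0 < c₂ := by positivity
  set ε : ℝ := (c₂ / 2) ^ β⁻¹ with hεdef
  have hε : 0 < ε := by positivity
  have hεβ : ε ^ β = c₂ / 2 := Real.rpow_inv_rpow (by positivity) hβ.ne'
  set K : ℝ := ((ε / 2) ^ (2 * β + d))⁻¹ with hKdef
  have hK : 0 ≤ K := by positivity
  refine ⟨(4 * Real.exp K)⁻¹, by positivity, ?_⟩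
  filter_upwards [eventually_exists_even_near_rpow hε hρ, eventually_gt_atTop 0]
    with n ⟨m, hm, hlow, hup⟩ hn f hf
  have hn0 : (0 : ℝ) < n := by exact_mod_cast hn
  set N : ℕ := 2 * m with hN
  have hN1 : (1 : ℝ) ≤ N := by exact_mod_cast (by omega : 1 ≤ N)
  have hN0 : (0 : ℝ) < N := by linarith
  have hNm : (N : ℝ) = 2 * m := by rw [hN]; push_cast; rfl
  set B : ℝ := ((d : ℝ) * N) ^ β with hB
  have hBN : B = (d : ℝ) ^ β * (N : ℝ) ^ β := Real.mul_rpow hd0.le hN0.le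
  have hNB : (N : ℝ) ^ β ≤ B := by
    refine Real.rpow_le_rpow hN0.le ?_ hβ.le
    exact le_mul_of_one_le_left hN0.le (by exact_mod_cast hd)
  have hNβ : 1 ≤ (N : ℝ) ^ β := Real.one_le_rpow hN1 hβ.le
  set V : ℝ := (2 * (N : ℝ) + 1) ^ d with hV
  have hV0 : 0 < V := by positivity
  have hB0 : 0 < B := by linarith
  set a : ℝ := L / 4 / ((1 + B) * V) with hadef
  have ha : 0 ≤ a := by positivity
  have haV : a * ((1 + B) * V) = L / 4 := div_mul_cancel₀ _ (by positivity)
  have hLs : L = 2 * (L / 2) := by ring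
  rw [hLs]
  refine exists_large_error (N := N) (a := a) hβ (by positivity) ha hK ?_ ?_ ?_ hf
  · rw [haV]
    linarith
  · have hNV : (N : ℝ) ^ d ≤ V := pow_le_pow_left₀ hN0.le (by linarith) d
    have hpow : (ε / 2) ^ (2 * β + d) * (n : ℝ) ^ d ≤ (N : ℝ) ^ β * (N : ℝ) ^ β * (N : ℝ) ^ d := by
      calc (ε / 2) ^ (2 * β + d) * (n : ℝ) ^ d
          = (ε / 2 * (n : ℝ) ^ ρ) ^ (2 * β + d) := by
            rw [Real.mul_rpow (by positivity) (by positivity), ← Real.rpow_mul hn0.le, hρdef,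
              div_mul_cancel₀ _ (by positivity), Real.rpow_natCast]
        _ ≤ (N : ℝ) ^ (2 * β + d) := Real.rpow_le_rpow (by positivity) hlow (by positivity)
        _ = _ := by rw [two_mul, Real.rpow_add hN0, Real.rpow_add hN0, Real.rpow_natCast]
    have hnK : (n : ℝ) ^ d ≤ K * ((1 + B) ^ 2 * V) := by
      rw [hKdef, inv_mul_eq_div, le_div_iff₀ (by positivity), mul_comm]
      refine hpow.trans ?_
      rw [← sq]
      gcongr
      linarith
    have ha2 : V * a ^ 2 * ((1 + B) ^ 2 * V) = (L / 4) ^ 2 := by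
      rw [← haV]
      ring
    calc (n : ℝ) ^ d * (V * a ^ 2) ≤ K * ((1 + B) ^ 2 * V) * (V * a ^ 2) := by gcongr
      _ = K * (L / 4) ^ 2 := by rw [← ha2]; ring
      _ ≤ K * (L / 2) ^ 2 := by gcongr; norm_num
  · have hcos := sum_cos_sq_ge (d := d) m θ
    rw [← hN] at hcos
    have hVm : V ≤ 2 ^ d * (2 * (m : ℝ) + 1) ^ d := by
      rw [← mul_pow]
      exact pow_le_pow_left₀ (by positivity) (by linarith) d
    have hsep : c₂ * ((N : ℝ) ^ β)⁻¹ ≤ ((2 * Real.pi) ^ d)⁻¹ *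
        (a * ∑ k ∈ latticeBox d N, Real.cos (∑ i, (k i : ℝ) * θ i) ^ 2) := by
      have h1 : L / (64 * 2 ^ d * (d : ℝ) ^ β) * ((N : ℝ) ^ β)⁻¹ ≤
          a * ((2 * (m : ℝ) + 1) ^ d / 8) := by
        have h2 : L / (64 * 2 ^ d * (d : ℝ) ^ β) * ((N : ℝ) ^ β)⁻¹ = L / (64 * 2 ^ d * B) := by
          rw [hBN]
          field_simp
        rw [h2, hadef, div_mul_div_comm, div_le_div_iff₀ (by positivity)
          (by positivity)]
        have h3 : (1 + B) * V ≤ (2 * B) * (2 ^ d * (2 * (m : ℝ) + 1) ^ d) := by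
          gcongr
          linarith
        nlinarith
      rw [hc₂def, mul_div_assoc, mul_assoc]
      exact mul_le_mul_of_nonneg_left (h1.trans (by gcongr)) (by positivity)
    have hrate : 2 * (n : ℝ) ^ (-((d : ℝ) * β) / (2 * β + d)) ≤ c₂ * ((N : ℝ) ^ β)⁻¹ := by
      have h1 : (N : ℝ) ^ β ≤ c₂ / 2 * (n : ℝ) ^ (ρ * β) := by
        rw [← hεβ, Real.rpow_mul hn0.le, ← Real.mul_rpow hε.le (by positivity)]
        exact Real.rpow_le_rpow hN0.le hup hβ.le
      have h2 : -((d : ℝ) * β) / (2 * β + d) = -(ρ * β) := by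
        rw [hρdef]
        ring
      rw [h2, Real.rpow_neg hn0.le, ← div_eq_mul_inv, ← div_eq_mul_inv,
        div_le_div_iff₀ (by positivity) (by positivity)]
      linarith
    rw [specVal_bumpCov, specVal_bumpCov]
    refine (hrate.trans hsep).trans ((le_of_eq ?_).trans (le_abs_self _))
    ring

/-- Theorem 6.1 (scalar real-valued case): minimax lower bound of rate `n^{-dβ/(2β+d)}`
for pointwise estimation of the spectral density at an interior point `θ₀ ∈ (-π,π)^d`
over the power-law class `P_D(β,L)`, based on Gaussian observations on `{1,…,n}^d`. -/
theorem stmt12 (d : ℕ) (hd : 1 ≤ d) (β L : ℝ) (hβ : 0 < β) (hL : 0 < L)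
    (θ₀ : Fin d → ℝ) (hθ₀ : ∀ i, θ₀ i ∈ Set.Ioo (-Real.pi) Real.pi) :
    0 < Filter.liminf (fun n : ℕ =>
      ⨅ fhat : {f : ((Fin d → Fin n) → ℝ) → ℝ // Measurable f},
        ⨆ C : {C : (Fin d → ℤ) → ℝ // PLD d β L C},
          ⨆ _P : {P : Measure ((Fin d → Fin n) → ℝ) //
              IsCenteredGaussianCov P (Matrix.of fun j k : Fin d → Fin n =>
                C.1 fun i => (j i : ℤ) - (k i : ℤ))},
            (_P.1 {x | (n : ℝ) ^ (-((d : ℝ) * β) / (2 * β + d)) ≤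
              |fhat.1 x - specVal d C.1 θ₀|}).toReal) Filter.atTop := by
  obtain ⟨c, hc, hev⟩ := eventually_forall_exists_large_error hd hβ hL θ₀
  have hle : ∀ (n : ℕ) (S : Matrix (Fin d → Fin n) (Fin d → Fin n) ℝ)
      (P : {P : Measure ((Fin d → Fin n) → ℝ) // IsCenteredGaussianCov P S}) A,
      (P.1 A).toReal ≤ 1 := fun n S P A =>
    have := P.2.1
    measureReal_le_one
  refine hc.trans_le (le_liminf_of_le (isCoboundedUnder_ge_of_le atTop (x := 1) fun n => ?_) ?_)
  · refine ciInf_le_of_le ⟨0, ?_⟩ ⟨fun _ => 0, measurable_const⟩ ?_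
    · rintro _ ⟨f, rfl⟩
      exact Real.iSup_nonneg fun C => Real.iSup_nonneg fun P => ENNReal.toReal_nonneg
    · exact Real.iSup_le (fun C => Real.iSup_le (fun P => hle n _ P _) zero_le_one) zero_le_one
  · filter_upwards [hev] with n hn
    have : Nonempty {f : ((Fin d → Fin n) → ℝ) → ℝ // Measurable f} :=
      ⟨⟨fun _ => 0, measurable_const⟩⟩
    refine le_ciInf fun f => ?_
    obtain ⟨C, hC, P, hP, hcP⟩ := hn f.1 f.2
    refine le_ciSup_of_le ⟨1, ?_⟩ ⟨C, hC⟩ (le_ciSup_of_le ⟨1, ?_⟩ ⟨P, hP⟩ hcP)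
    · rintro _ ⟨C, rfl⟩
      exact Real.iSup_le (fun P => hle n _ P _) zero_le_one
    · rintro _ ⟨P, rfl⟩
      exact hle n _ P _
end

section
/- Fix an integer d ≥ 1, reals β > 0 and L > 0, a point θ₀ ∈ ℝ^d, and a sequence of positive reals δ_n with n·δ_n → ∞. Let 𝒞_C(β,L) be the set of continuous functions C : ℝ^d → ℝ such that C(x) = C(−x) for all x, ∫_{ℝ^d} (1 + ‖x‖₂^β)·|C(x)| dx ≤ L, and C is positive definite (for every finite set of points x₁,…,x_N ∈ ℝ^d the matrix (C(x_i − x_j))_{i,j} is positive semidefinite). For C ∈ 𝒞_C(β,L) set f_C(θ₀) := (2π)^{−d} ∫_{ℝ^d} e^{i x·θ₀} C(x) dx (a real number), and let P_{n,C} denote the centered Gaussian probability measure on ℝ^{T_n}, T_n := {1,…,n}^d, with covariance matrix (C(δ_n·(j−k)))_{j,k∈T_n}. Then liminf_{n→∞} inf_{f̂_n} sup_{C∈𝒞_C(β,L)} P_{n,C}( { x ∈ ℝ^{T_n} : |f̂_n(x) − f_C(θ₀)| ≥ (n·δ_n)^{−dβ/(2β+d)} } ) > 0, where the infimum is over all Borel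 measurable maps f̂_n : ℝ^{T_n} → ℝ. -/
open MeasureTheory ProbabilityTheory Filter
open scoped Classical

/-- The Euclidean norm `‖x‖₂` of a point `x ∈ ℝ^d`. -/
noncomputable def rnorm {d : ℕ} (x : Fin d → ℝ) : ℝ := Real.sqrt (∑ i, (x i) ^ 2)

/-- The continuous-time power-law covariance class `P_C(β,L)` on `ℝ^d`: continuous,
symmetric, with `∫ (1+‖x‖₂^β)|C(x)| dx ≤ L`, and positive definite. -/
def PLC (d : ℕ) (β L : ℝ) (C : (Fin d → ℝ) → ℝ) : Prop :=
  Continuous C ∧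
  (∀ x, C x = C (-x)) ∧
  Integrable (fun x : Fin d → ℝ => (1 + rnorm x ^ β) * |C x|) ∧
  (∫ x : Fin d → ℝ, (1 + rnorm x ^ β) * |C x|) ≤ L ∧
  ∀ (N : ℕ) (pts : Fin N → Fin d → ℝ) (y : Fin N → ℝ),
    0 ≤ ∑ i, ∑ j, y i * C (pts i - pts j) * y j

/-- The value `f_C(θ₀) = (2π)^{-d} ∫_{ℝ^d} e^{i x·θ₀} C(x) dx` of the spectral density
(a real number by the symmetry of `C`, obtained as the real part of the complex integral). -/
noncomputable def specValC (d : ℕ) (C : (Fin d → ℝ) → ℝ) (θ : Fin d → ℝ) : ℝ :=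
  ((2 * Real.pi) ^ d)⁻¹ *
    (∫ x : Fin d → ℝ, (C x : ℂ) * Complex.exp (Complex.I * ∑ i, x i * θ i)).re

/-! ### Hellinger affinity of Gaussian product measures -/

theorem pi_withDensity_prod {ι : Type*} [Fintype ι] (μ : ι → Measure ℝ)
    [∀ i, IsProbabilityMeasure (μ i)] (f : ι → ℝ → ENNReal) (hf : ∀ i, Measurable (f i))
    (ν : ι → Measure ℝ) [∀ i, IsProbabilityMeasure (ν i)]
    (h : ∀ i, ν i = (μ i).withDensity (f i)) :
    Measure.pi ν = (Measure.pi μ).withDensity fun x => ∏ i, f i (x i) := by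
  refine Measure.pi_eq fun s hs => ?_
  rw [withDensity_apply _ (MeasurableSet.univ_pi hs), ← lintegral_indicator (MeasurableSet.univ_pi hs)]
  have hI : iIndepFun (fun i (x : ι → ℝ) => (s i).indicator (f i) (x i)) (Measure.pi μ) :=
    iIndepFun_pi fun i => ((hf i).indicator (hs i)).aemeasurable
  have key := lintegral_prod_eq_prod_lintegral_of_indepFun Finset.univ _ hI
    fun i => ((hf i).indicator (hs i)).comp (measurable_pi_apply i)
  calc _ = ∫⁻ x, ∏ i, (s i).indicator (f i) (x i) ∂Measure.pi μ := by
        refine lintegral_congr fun x => ?_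
        by_cases hx : x ∈ Set.univ.pi s
        · rw [Set.indicator_of_mem hx]
          exact Finset.prod_congr rfl fun i _ => by
            rw [Set.indicator_of_mem (hx i (Set.mem_univ i))]
        · rw [Set.indicator_of_notMem hx]
          simp only [Set.mem_pi, Set.mem_univ, true_implies, not_forall] at hx
          obtain ⟨i, hi⟩ := hx
          exact (Finset.prod_eq_zero (Finset.mem_univ i) (Set.indicator_of_notMem hi _)).symm
    _ = _ := by
        rw [key]
        refine Finset.prod_congr rfl fun i _ => ?_
        rw [h i, withDensity_apply _ (hs i), ← lintegral_indicator (hs i)]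
        exact (measurePreserving_eval μ i).lintegral_comp ((hf i).indicator (hs i))

theorem setLIntegral_le_sqrt_mul_sqrt {α : Type*} [MeasurableSpace α] (μ : Measure α)
    {S : α → ENNReal} (hS : Measurable S) {A : Set α} (hA : MeasurableSet A) :
    ∫⁻ x in A, S x ∂μ ≤
      μ A ^ (1 / 2 : ℝ) * (μ.withDensity fun x => S x ^ 2) A ^ (1 / 2 : ℝ) := by
  have h := ENNReal.lintegral_mul_le_Lp_mul_Lq (μ.restrict A) Real.HolderConjugate.two_two
    (f := fun _ => 1) (g := S) aemeasurable_const hS.aemeasurable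
  rw [withDensity_apply _ hA]
  simpa using h

theorem lintegral_le_sqrt_add_sqrt {α : Type*} [MeasurableSpace α] (μ ν : Measure α)
    [IsProbabilityMeasure μ] [IsProbabilityMeasure ν]
    {S : α → ENNReal} (hS : Measurable S) (hν : ν = μ.withDensity fun x => S x ^ 2)
    {A : Set α} (hA : MeasurableSet A) :
    ∫⁻ x, S x ∂μ ≤ μ A ^ (1 / 2 : ℝ) + ν Aᶜ ^ (1 / 2 : ℝ) := by
  rw [← lintegral_add_compl S hA]
  have h1 := setLIntegral_le_sqrt_mul_sqrt μ hS hA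
  have h2 := setLIntegral_le_sqrt_mul_sqrt μ hS hA.compl
  rw [← hν] at h1 h2
  refine add_le_add (h1.trans ?_) (h2.trans ?_)
  · exact mul_le_of_le_one_right' (ENNReal.rpow_le_one prob_le_one (by norm_num))
  · exact mul_le_of_le_one_left' (ENNReal.rpow_le_one prob_le_one (by norm_num))

/-- Square root of the density of `N(0,w)` with respect to `N(0,1)`. -/
noncomputable def sqrtDens (w x : ℝ) : ℝ :=
  Real.exp (-(Real.log w) / 4 + x ^ 2 / 4 * (1 - w⁻¹))

theorem gaussianReal_eq_withDensity_sqrtDens {w : NNReal} (hw : 0 < w) :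
    gaussianReal 0 w =
      (gaussianReal 0 1).withDensity fun x => ENNReal.ofReal (sqrtDens w x) ^ 2 := by
  have hw' : (0 : ℝ) < w := hw
  rw [gaussianReal_of_var_ne_zero 0 hw.ne', gaussianReal_of_var_ne_zero 0 one_ne_zero,
    ← withDensity_mul _ (measurable_gaussianPDF 0 1) (by unfold sqrtDens; fun_prop)]
  congr 1
  ext x
  simp only [gaussianPDF, Pi.mul_apply]
  rw [← ENNReal.ofReal_pow (by unfold sqrtDens; positivity), ← ENNReal.ofReal_mul (gaussianPDFReal_nonneg _ _ _)]
  congr 1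
  simp only [gaussianPDFReal, sqrtDens, ← Real.exp_nat_mul, sub_zero, NNReal.coe_one, mul_one]
  rw [Real.sqrt_mul (by positivity), mul_inv, mul_assoc, mul_assoc]
  congr 1
  have : (√(w : ℝ))⁻¹ = Real.exp (-(Real.log w) / 2) := by
    rw [← Real.exp_log (inv_pos.2 (Real.sqrt_pos.2 hw')), Real.log_inv, Real.log_sqrt hw'.le]
    congr 1; ring
  rw [this, ← Real.exp_add, ← Real.exp_add]
  congr 1
  push_cast
  field_simp
  ring

theorem lintegral_sqrtDens {w : NNReal} (hw : 0 < w) :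
    ∫⁻ x, ENNReal.ofReal (sqrtDens w x) ∂gaussianReal 0 1 =
      ENNReal.ofReal (Real.exp (-(Real.log w) / 4) * √(2 * w / (1 + w))) := by
  have hw' : (0 : ℝ) < w := hw
  have hfm : Measurable fun x => ENNReal.ofReal (sqrtDens w x) := by unfold sqrtDens; fun_prop
  rw [gaussianReal_of_var_ne_zero 0 one_ne_zero,
    lintegral_withDensity_eq_lintegral_mul _ (measurable_gaussianPDF 0 1) hfm]
  have hb : 0 < (1 + (w : ℝ)) / (4 * w) := by positivity
  have heq : ∀ x, gaussianPDFReal 0 1 x * sqrtDens w x =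
      (√(2 * Real.pi))⁻¹ * Real.exp (-(Real.log w) / 4) *
        Real.exp (-((1 + (w : ℝ)) / (4 * w)) * x ^ 2) := fun x => by
    simp only [gaussianPDFReal, sqrtDens, NNReal.coe_one, mul_one, sub_zero]
    rw [mul_assoc, mul_assoc, ← Real.exp_add, ← Real.exp_add]
    congr 2
    field_simp
    ring
  have : ∀ x, (gaussianPDF 0 1 * fun x => ENNReal.ofReal (sqrtDens w x)) x =
      ENNReal.ofReal ((√(2 * Real.pi))⁻¹ * Real.exp (-(Real.log w) / 4) *
        Real.exp (-((1 + (w : ℝ)) / (4 * w)) * x ^ 2)) := fun x => by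
    rw [Pi.mul_apply, gaussianPDF, ← ENNReal.ofReal_mul (gaussianPDFReal_nonneg _ _ _), heq]
  rw [lintegral_congr this, ← ofReal_integral_eq_lintegral_ofReal
    ((integrable_exp_neg_mul_sq hb).const_mul _) (ae_of_all _ fun x => by positivity),
    integral_const_mul, integral_gaussian]
  congr 1
  rw [mul_comm (√(2 * Real.pi))⁻¹, mul_assoc, ← Real.sqrt_inv, ← Real.sqrt_mul (by positivity)]
  congr 2
  field_simp
  ring

theorem exp_neg_sq_le_affinity {l : ℝ} (hl : 0 ≤ l) :
    Real.exp (-(l ^ 2 / 16)) ≤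
      Real.exp (-(Real.log (1 + l)) / 4) * √(2 * (1 + l) / (1 + (1 + l))) := by
  have h1 : 0 < 1 + l := by linarith
  have h2 : 0 < 2 * (1 + l) / (1 + (1 + l)) := by positivity
  rw [← Real.exp_log (Real.sqrt_pos.2 h2), ← Real.exp_add, Real.exp_le_exp, Real.log_sqrt h2.le]
  have h3 : Real.log ((2 * (1 + l) / (1 + (1 + l)))⁻¹ ^ 2 * (1 + l)) ≤ l ^ 2 / 4 := by
    refine (Real.log_le_sub_one_of_pos (by positivity)).trans ?_
    have : (2 * (1 + l) / (1 + (1 + l)))⁻¹ ^ 2 * (1 + l) - 1 = l ^ 2 / (4 * (1 + l)) := by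
      field_simp; ring
    rw [this]
    exact div_le_div_of_nonneg_left (sq_nonneg l) (by norm_num) (by linarith)
  rw [Real.log_mul (by positivity) h1.ne', Real.log_pow, Real.log_inv] at h3
  push_cast at h3
  linarith

theorem exp_le_sqrt_add_sqrt_pi_gaussian {ι : Type*} [Fintype ι] (l : ι → ℝ) (hl : ∀ i, 0 ≤ l i)
    {A : Set (ι → ℝ)} (hA : MeasurableSet A) :
    Real.exp (-(∑ i, l i ^ 2) / 16) ≤
      √((Measure.pi fun _ : ι => gaussianReal 0 1) A).toReal +
      √((Measure.pi fun i => gaussianReal 0 (1 + l i).toNNReal) Aᶜ).toReal := by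
  have hw : ∀ i, 0 < (1 + l i).toNNReal := fun i => Real.toNNReal_pos.2 (by linarith [hl i])
  have hwc : ∀ i, ((1 + l i).toNNReal : ℝ) = 1 + l i := fun i =>
    Real.coe_toNNReal _ (by linarith [hl i])
  have hm : ∀ w, Measurable fun x => ENNReal.ofReal (sqrtDens w x) := fun w => by
    unfold sqrtDens; fun_prop
  set S : (ι → ℝ) → ENNReal := fun x => ∏ i, ENNReal.ofReal (sqrtDens (1 + l i) (x i)) with hS
  have hSm : Measurable S := Finset.measurable_prod _ fun i _ => (hm _).comp (measurable_pi_apply i)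
  have hdens : (Measure.pi fun i => gaussianReal 0 (1 + l i).toNNReal) =
      (Measure.pi fun _ : ι => gaussianReal 0 1).withDensity fun x => S x ^ 2 := by
    simp only [hS, ← Finset.prod_pow]
    refine pi_withDensity_prod (fun _ => gaussianReal 0 1)
      (fun i x => ENNReal.ofReal (sqrtDens (1 + l i) x) ^ 2) (fun i => (hm _).pow_const 2) _ fun i => ?_
    have := gaussianReal_eq_withDensity_sqrtDens (hw i)
    rwa [hwc] at this
  have key := lintegral_le_sqrt_add_sqrt _ _ hSm hdens hA
  have hI : ∫⁻ x, S x ∂(Measure.pi fun _ : ι => gaussianReal 0 1) =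
      ∏ i, ENNReal.ofReal (Real.exp (-(Real.log (1 + l i)) / 4) *
        √(2 * (1 + l i) / (1 + (1 + l i)))) := by
    have hind : iIndepFun (fun i (x : ι → ℝ) => ENNReal.ofReal (sqrtDens (1 + l i) (x i)))
        (Measure.pi fun _ : ι => gaussianReal 0 1) :=
      iIndepFun_pi fun i => (hm _).aemeasurable
    rw [hS, lintegral_prod_eq_prod_lintegral_of_indepFun Finset.univ _ hind
      fun i => (hm _).comp (measurable_pi_apply i)]
    refine Finset.prod_congr rfl fun i _ => ?_
    have := lintegral_sqrtDens (hw i)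
    rw [hwc] at this
    rw [← this]
    exact (measurePreserving_eval (fun _ : ι => gaussianReal 0 1) i).lintegral_comp (hm _)
  have hlow : ENNReal.ofReal (Real.exp (-(∑ i, l i ^ 2) / 16)) ≤
      ∫⁻ x, S x ∂(Measure.pi fun _ : ι => gaussianReal 0 1) := by
    rw [hI, neg_div, Finset.sum_div, ← Finset.sum_neg_distrib, Real.exp_sum,
      ENNReal.ofReal_prod_of_nonneg fun i _ => (Real.exp_pos _).le]
    exact Finset.prod_le_prod' fun i _ => ENNReal.ofReal_le_ofReal (exp_neg_sq_le_affinity (hl i))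
  have hfin := hlow.trans key
  have hne : ∀ (μ : Measure (ι → ℝ)) [IsProbabilityMeasure μ] (B : Set (ι → ℝ)),
      μ B ^ (1 / 2 : ℝ) ≠ ⊤ := fun μ _ B =>
    ENNReal.rpow_ne_top_of_nonneg (by norm_num) (measure_ne_top μ B)
  rw [ENNReal.ofReal_le_iff_le_toReal (ENNReal.add_ne_top.2 ⟨hne _ _, hne _ _⟩),
    ENNReal.toReal_add (hne _ _) (hne _ _)] at hfin
  simpa only [← ENNReal.toReal_rpow, ← Real.sqrt_eq_rpow] using hfin

/-! ### Linear images of Gaussian product measures -/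

theorem map_sum_mul_pi_gaussianReal {ι : Type*} [Fintype ι] (w : ι → NNReal) (y : ι → ℝ) :
    Measure.map (fun ω => ∑ i, y i * ω i) (Measure.pi fun i => gaussianReal 0 (w i)) =
      gaussianReal 0 (∑ i, y i ^ 2 * (w i : ℝ)).toNNReal := by
  have hm : Measurable fun ω : ι → ℝ => ∑ i, y i * ω i := by fun_prop
  have : IsProbabilityMeasure (Measure.map (fun ω : ι → ℝ => ∑ i, y i * ω i)
    (Measure.pi fun i => gaussianReal 0 (w i))) := Measure.isProbabilityMeasure_map hm.aemeasurable
  refine Measure.ext_of_charFun ?_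
  ext t
  rw [charFun_gaussianReal, charFun_apply_real, integral_map hm.aemeasurable (by fun_prop)]
  have h1 : ∀ x : ι → ℝ, Complex.exp (t * ((∑ i, y i * x i : ℝ) : ℂ) * Complex.I) =
      ∏ i, Complex.exp (((t * y i : ℝ) : ℂ) * (x i : ℂ) * Complex.I) := fun x => by
    rw [← Complex.exp_sum]
    congr 1
    push_cast
    rw [Finset.mul_sum, Finset.sum_mul]
    exact Finset.sum_congr rfl fun i _ => by ring
  simp_rw [h1]
  rw [integral_fintype_prod_eq_prod
    (fun i (x : ℝ) => Complex.exp (((t * y i : ℝ) : ℂ) * (x : ℂ) * Complex.I))]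
  simp_rw [← charFun_apply_real, charFun_gaussianReal]
  rw [← Complex.exp_sum, Real.coe_toNNReal _ (Finset.sum_nonneg fun i _ => by positivity)]
  congr 1
  push_cast
  rw [Finset.sum_mul, Finset.sum_div]
  simp only [mul_zero, zero_mul, zero_sub]
  rw [← Finset.sum_neg_distrib]
  exact Finset.sum_congr rfl fun i _ => by ring

/-- The law of `M Z`, where `Z` has independent `N(0, w a)` coordinates. -/
noncomputable def gaussianImage {T ι : Type*} [Fintype ι] (M : T → ι → ℝ) (w : ι → NNReal) :
    Measure (T → ℝ) :=
  (Measure.pi fun a => gaussianReal 0 (w a)).map fun z j => ∑ a, M j a * z a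

theorem measurable_gaussianImage_map {T ι : Type*} [Fintype ι] (M : T → ι → ℝ) :
    Measurable fun (z : ι → ℝ) (j : T) => ∑ a, M j a * z a := by fun_prop

theorem isCenteredGaussianCov_gaussianImage {T ι : Type*} [Fintype T] [Fintype ι]
    (M : T → ι → ℝ) (w : ι → NNReal) (S : Matrix T T ℝ)
    (hS : ∀ j k, S j k = ∑ a, (w a : ℝ) * M j a * M k a) :
    IsCenteredGaussianCov (gaussianImage M w) S := by
  have hm := measurable_gaussianImage_map M
  refine ⟨Measure.isProbabilityMeasure_map hm.aemeasurable, fun x => ?_⟩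
  rw [gaussianImage, Measure.map_map (by fun_prop) hm]
  have h1 : ((fun ω : T → ℝ => ∑ j, x j * ω j) ∘ fun (z : ι → ℝ) (j : T) => ∑ a, M j a * z a) =
      fun z => ∑ a, (∑ j, x j * M j a) * z a := by
    ext z
    simp only [Function.comp_apply, Finset.mul_sum, Finset.sum_mul]
    rw [Finset.sum_comm]
    exact Finset.sum_congr rfl fun i _ => Finset.sum_congr rfl fun j _ => by ring
  rw [h1, map_sum_mul_pi_gaussianReal]
  congr 2
  have h2 : ∀ j, ∑ k, x j * S j k * x k = ∑ a, ∑ k, x j * (w a * M j a * M k a) * x k := fun j => by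
    rw [Finset.sum_comm]
    exact Finset.sum_congr rfl fun k _ => by rw [hS, Finset.mul_sum, Finset.sum_mul]
  simp_rw [h2]
  rw [Finset.sum_comm]
  refine Finset.sum_congr rfl fun a _ => ?_
  rw [sq, Finset.sum_mul_sum, Finset.sum_mul]
  refine Finset.sum_congr rfl fun j _ => ?_
  rw [Finset.sum_mul]
  exact Finset.sum_congr rfl fun k _ => by ring

theorem exp_le_sqrt_add_sqrt_gaussianImage {T ι : Type*} [Fintype ι] (M : T → ι → ℝ)
    (l : ι → ℝ) (hl : ∀ a, 0 ≤ l a) {V : ℝ} (hV : ∑ a, l a ^ 2 ≤ V)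
    {A : Set (T → ℝ)} (hA : MeasurableSet A) :
    Real.exp (-V / 16) ≤ √(gaussianImage M (fun _ => 1) A).toReal +
      √(gaussianImage M (fun a => (1 + l a).toNNReal) Aᶜ).toReal := by
  have hm := measurable_gaussianImage_map M
  rw [gaussianImage, gaussianImage, Measure.map_apply hm hA, Measure.map_apply hm hA.compl,
    Set.preimage_compl]
  refine le_trans ?_ (exp_le_sqrt_add_sqrt_pi_gaussian l hl (hm hA))
  rw [Real.exp_le_exp]
  linarith

/-! ### Simultaneous diagonalization of a Gram matrix and a bilinear form -/

open scoped InnerProductSpace in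
theorem exists_simultaneous_diagonalization {E T : Type*} [NormedAddCommGroup E]
    [InnerProductSpace ℝ E] [Finite T] (v : T → E) (B : E →ₗ[ℝ] E →ₗ[ℝ] ℝ)
    (hsymm : ∀ f g, B f g = B g f) (hpos : ∀ f, 0 ≤ B f f) {κ τ : ℝ}
    (hκ : ∀ f, B f f ≤ κ * ‖f‖ ^ 2)
    (hτ : ∀ (m : ℕ) (e : Fin m → E), Orthonormal ℝ e → ∑ a, B (e a) (e a) ≤ τ) (hκ0 : 0 ≤ κ) :
    ∃ (m : ℕ) (M : T → Fin m → ℝ) (l : Fin m → ℝ), (∀ a, 0 ≤ l a) ∧ ∑ a, l a ^ 2 ≤ κ * τ ∧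
      (∀ j k, ⟪v j, v k⟫_ℝ = ∑ a, M j a * M k a) ∧
      ∀ j k, B (v j) (v k) = ∑ a, l a * M j a * M k a := by
  let U : Submodule ℝ E := Submodule.span ℝ (Set.range v)
  have : FiniteDimensional ℝ U := FiniteDimensional.span_of_finite ℝ (Set.finite_range v)
  let b := stdOrthonormalBasis ℝ U
  let A : U →ₗ[ℝ] U :=
    ∑ a, ((B.flip (b a)).comp U.subtype).smulRight (b a)
  have hA : ∀ u w : U, ⟪A u, w⟫_ℝ = B u w := fun u w => by
    conv_rhs => rw [← b.sum_repr' w]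
    simp [A, sum_inner, inner_smul_left, mul_comm]
  have hAs : A.IsSymmetric := fun u w => by
    rw [hA, hsymm, ← hA, real_inner_comm]
  let e := hAs.eigenvectorBasis rfl
  let l := hAs.eigenvalues rfl
  have hl : ∀ a, l a = B (e a) (e a) := fun a => by
    rw [← hA, hAs.apply_eigenvectorBasis]
    simp [inner_smul_left, e, l]
  have hn : ∀ a, ‖((e a : U) : E)‖ = 1 := fun a => e.orthonormal.1 a
  have hl0 : ∀ a, 0 ≤ l a := fun a => (hpos _).trans_eq (hl a).symm
  have hlκ : ∀ a, l a ≤ κ := fun a => by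
    rw [hl]
    simpa [hn a] using hκ (e a)
  let v' : T → U := fun j => ⟨v j, Submodule.subset_span ⟨j, rfl⟩⟩
  refine ⟨_, fun j a => ⟪e a, v' j⟫_ℝ, l, hl0, ?_, fun j k => ?_, fun j k => ?_⟩
  · calc ∑ a, l a ^ 2 ≤ ∑ a, κ * l a := Finset.sum_le_sum fun a _ => by
          rw [sq]; exact mul_le_mul_of_nonneg_right (hlκ a) (hl0 a)
      _ = κ * ∑ a, B (e a) (e a) := by rw [← Finset.mul_sum]; simp only [hl]
      _ ≤ κ * τ := mul_le_mul_of_nonneg_left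
          (hτ _ (fun a => (e a : E)) (e.orthonormal.comp_linearIsometry U.subtypeₗᵢ)) hκ0
  · change ⟪v' j, v' k⟫_ℝ = _
    rw [← e.sum_inner_mul_inner]
    exact Finset.sum_congr rfl fun a _ => by rw [real_inner_comm]
  · change B (v' j) (v' k) = _
    rw [← hA, ← e.sum_inner_mul_inner]
    refine Finset.sum_congr rfl fun a _ => ?_
    rw [hAs, hAs.apply_eigenvectorBasis, inner_smul_right, real_inner_comm]
    rfl

/-! ### Windowed bilinear forms on `L²(ℝ^d)` -/

theorem memLp_indicator_closedBall {d : ℕ} {c : (Fin d → ℝ) → ℝ} (hc : Measurable c)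
    (hb : ∀ u, |c u| ≤ 1) (r : ℝ) (s : Fin d → ℝ) :
    MemLp ((Metric.closedBall s r).indicator c) 2 volume := by
  rw [memLp_indicator_iff_restrict measurableSet_closedBall]
  have : IsFiniteMeasure (volume.restrict (Metric.closedBall s r)) :=
    ⟨by rw [Measure.restrict_apply_univ]; exact measure_closedBall_lt_top⟩
  exact MemLp.of_bound hc.aestronglyMeasurable 1 (ae_of_all _ hb)

/-- The function `c` restricted to the window `closedBall s r`, as an element of `L²`. -/
noncomputable def windowVec {d : ℕ} {c : (Fin d → ℝ) → ℝ} (hc : Measurable c)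
    (hb : ∀ u, |c u| ≤ 1) (r : ℝ) (s : Fin d → ℝ) : Lp ℝ 2 (volume : Measure (Fin d → ℝ)) :=
  (memLp_indicator_closedBall hc hb r s).toLp _

section Window

open scoped InnerProductSpace

variable {d : ℕ} {c : (Fin d → ℝ) → ℝ} (hc : Measurable c) (hb : ∀ u, |c u| ≤ 1) (r : ℝ)

theorem inner_toLp {f : (Fin d → ℝ) → ℝ} (hf : MemLp f 2 volume)
    (g : Lp ℝ 2 (volume : Measure (Fin d → ℝ))) :
    ⟪hf.toLp f, g⟫_ℝ = ∫ u, f u * g u := by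
  rw [L2.inner_def]
  refine integral_congr_ae ?_
  filter_upwards [hf.coeFn_toLp] with u hu
  rw [hu]
  simp [mul_comm]

theorem inner_windowVec (s : Fin d → ℝ) (f : Lp ℝ 2 (volume : Measure (Fin d → ℝ))) :
    ⟪windowVec hc hb r s, f⟫_ℝ = ∫ u, (Metric.closedBall s r).indicator c u * f u :=
  inner_toLp _ _

theorem norm_toLp_sq {f : (Fin d → ℝ) → ℝ} (hf : MemLp f 2 volume) :
    ‖hf.toLp f‖ ^ 2 = ∫ u, f u ^ 2 := by
  rw [← real_inner_self_eq_norm_sq, inner_toLp]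
  refine integral_congr_ae ?_
  filter_upwards [hf.coeFn_toLp] with u hu
  rw [hu, sq]

theorem volume_real_closedBall (s : Fin d → ℝ) {r : ℝ} (hr : 0 ≤ r) :
    volume.real (Metric.closedBall s r) = (2 * r) ^ d := by
  rw [Measure.real, Real.volume_pi_closedBall s hr, Fintype.card_fin,
    ENNReal.toReal_ofReal (by positivity)]

theorem norm_windowVec_sq_le (hr : 0 ≤ r) (s : Fin d → ℝ) :
    ‖windowVec hc hb r s‖ ^ 2 ≤ (2 * r) ^ d := by
  rw [windowVec, norm_toLp_sq, ← volume_real_closedBall s hr]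
  have h : ∫ u, (Metric.closedBall s r).indicator (fun _ => (1 : ℝ)) u =
      volume.real (Metric.closedBall s r) := by
    rw [integral_indicator measurableSet_closedBall]; simp
  rw [← h]
  refine integral_mono_of_nonneg (ae_of_all _ fun u => sq_nonneg _) ?_ (ae_of_all _ fun u => ?_)
  · exact (integrable_indicator_iff measurableSet_closedBall).2
      (integrableOn_const measure_closedBall_lt_top.ne)
  · by_cases hu : u ∈ Metric.closedBall s r
    · simp only [Set.indicator_of_mem hu]
      exact (sq_le_one_iff_abs_le_one _).2 (hb u)
    · simp [Set.indicator_of_notMem hu]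

theorem measurable_window : Measurable fun p : (Fin d → ℝ) × (Fin d → ℝ) =>
    (Metric.closedBall p.1 r).indicator (fun _ => (1 : ℝ)) p.2 := by
  have : MeasurableSet {p : (Fin d → ℝ) × (Fin d → ℝ) | dist p.2 p.1 ≤ r} :=
    (isClosed_le (by fun_prop) continuous_const).measurableSet
  exact (measurable_const (a := (1 : ℝ))).indicator this

theorem stronglyMeasurable_inner_windowVec (f : Lp ℝ 2 (volume : Measure (Fin d → ℝ))) :
    StronglyMeasurable fun s => ⟪windowVec hc hb r s, f⟫_ℝ := by
  simp_rw [inner_windowVec]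
  have h : Measurable fun p : (Fin d → ℝ) × (Fin d → ℝ) =>
      (Metric.closedBall p.1 r).indicator (fun _ => (1 : ℝ)) p.2 * c p.2 * f p.2 :=
    ((measurable_window r).mul (hc.comp measurable_snd)).mul
      ((Lp.stronglyMeasurable f).measurable.comp measurable_snd)
  convert h.stronglyMeasurable.integral_prod_right' (ν := volume) using 4 with s u
  by_cases hu : u ∈ Metric.closedBall s r <;> simp [hu]

theorem integrableOn_inner_windowVec (hr : 0 ≤ r) {S : Set (Fin d → ℝ)} (hS : volume S ≠ ⊤)
    (f g : Lp ℝ 2 (volume : Measure (Fin d → ℝ))) :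
    IntegrableOn (fun s => ⟪windowVec hc hb r s, f⟫_ℝ * ⟪windowVec hc hb r s, g⟫_ℝ) S := by
  refine Measure.integrableOn_of_bounded (M := (2 * r) ^ d * ‖f‖ * ‖g‖) hS
    ((stronglyMeasurable_inner_windowVec hc hb r f).mul
      (stronglyMeasurable_inner_windowVec hc hb r g)).aestronglyMeasurable (ae_of_all _ fun s => ?_)
  rw [norm_mul]
  calc _ ≤ (‖windowVec hc hb r s‖ * ‖f‖) * (‖windowVec hc hb r s‖ * ‖g‖) :=
        mul_le_mul (norm_inner_le_norm _ _) (norm_inner_le_norm _ _) (norm_nonneg _) (by positivity)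
    _ = ‖windowVec hc hb r s‖ ^ 2 * ‖f‖ * ‖g‖ := by ring
    _ ≤ _ := by gcongr; exact norm_windowVec_sq_le hc hb r hr s

/-- The bilinear form `∫_S ⟪w_s, f⟫ ⟪w_s, g⟫ ds` built from the windows `w_s` of radius `r`. -/
noncomputable def windowForm (hr : 0 ≤ r) {S : Set (Fin d → ℝ)} (hS : volume S ≠ ⊤) :
    Lp ℝ 2 (volume : Measure (Fin d → ℝ)) →ₗ[ℝ] Lp ℝ 2 (volume : Measure (Fin d → ℝ)) →ₗ[ℝ] ℝ :=
  LinearMap.mk₂ ℝ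
    (fun f g => ∫ s in S, ⟪windowVec hc hb r s, f⟫_ℝ * ⟪windowVec hc hb r s, g⟫_ℝ)
    (fun f f' g => by
      rw [← integral_add (integrableOn_inner_windowVec hc hb r hr hS f g)
        (integrableOn_inner_windowVec hc hb r hr hS f' g)]
      simp only [inner_add_right, add_mul])
    (fun a f g => by
      simp only [inner_smul_right, mul_assoc, smul_eq_mul, integral_const_mul])
    (fun f g g' => by
      rw [← integral_add (integrableOn_inner_windowVec hc hb r hr hS f g)
        (integrableOn_inner_windowVec hc hb r hr hS f g')]
      simp only [inner_add_right, mul_add])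
    (fun a f g => by
      simp only [inner_smul_right, mul_left_comm _ a, smul_eq_mul, integral_const_mul])

theorem windowForm_apply (hr : 0 ≤ r) {S : Set (Fin d → ℝ)} (hS : volume S ≠ ⊤)
    (f g : Lp ℝ 2 (volume : Measure (Fin d → ℝ))) :
    windowForm hc hb r hr hS f g =
      ∫ s in S, ⟪windowVec hc hb r s, f⟫_ℝ * ⟪windowVec hc hb r s, g⟫_ℝ := rfl

theorem windowForm_symm (hr : 0 ≤ r) {S : Set (Fin d → ℝ)} (hS : volume S ≠ ⊤)
    (f g : Lp ℝ 2 (volume : Measure (Fin d → ℝ))) :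
    windowForm hc hb r hr hS f g = windowForm hc hb r hr hS g f := by
  simp only [windowForm_apply, mul_comm]

theorem windowForm_self_nonneg (hr : 0 ≤ r) {S : Set (Fin d → ℝ)} (hS : volume S ≠ ⊤)
    (f : Lp ℝ 2 (volume : Measure (Fin d → ℝ))) : 0 ≤ windowForm hc hb r hr hS f f :=
  integral_nonneg fun _ => mul_self_nonneg _

theorem sum_windowForm_le (hr : 0 ≤ r) {S : Set (Fin d → ℝ)} (hS : volume S ≠ ⊤) (m : ℕ)
    (e : Fin m → Lp ℝ 2 (volume : Measure (Fin d → ℝ))) (he : Orthonormal ℝ e) :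
    ∑ a, windowForm hc hb r hr hS (e a) (e a) ≤ (2 * r) ^ d * volume.real S := by
  simp only [windowForm_apply]
  rw [← integral_finsetSum _ fun a _ => integrableOn_inner_windowVec hc hb r hr hS (e a) (e a)]
  calc _ ≤ ∫ _ in S, (2 * r) ^ d := by
        refine integral_mono (integrable_finsetSum _ fun a _ =>
          integrableOn_inner_windowVec hc hb r hr hS (e a) (e a)) (integrableOn_const hS) fun s => ?_
        refine le_trans ?_ (norm_windowVec_sq_le hc hb r hr s)
        refine le_trans (le_of_eq ?_) (he.sum_inner_products_le (s := Finset.univ) _)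
        refine Finset.sum_congr rfl fun a _ => ?_
        rw [real_inner_comm, ← sq, Real.norm_eq_abs, sq_abs]
    _ = _ := by simp [mul_comm]

theorem inner_windowVec_sq_le (hr : 0 ≤ r) (s : Fin d → ℝ)
    (f : Lp ℝ 2 (volume : Measure (Fin d → ℝ))) :
    ⟪windowVec hc hb r s, f⟫_ℝ ^ 2 ≤
      (2 * r) ^ d * ∫ u, (Metric.closedBall s r).indicator (fun _ => (1 : ℝ)) u * f u ^ 2 := by
  have hf : MemLp ((Metric.closedBall s r).indicator f) 2 volume :=
    (Lp.memLp f).indicator measurableSet_closedBall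
  have h1 : ⟪windowVec hc hb r s, f⟫_ℝ = ⟪windowVec hc hb r s, hf.toLp _⟫_ℝ := by
    rw [inner_windowVec, inner_windowVec]
    refine integral_congr_ae ?_
    filter_upwards [hf.coeFn_toLp] with u hu
    rw [hu]
    by_cases h : u ∈ Metric.closedBall s r <;> simp [h]
  have h2 : ‖hf.toLp _‖ ^ 2 =
      ∫ u, (Metric.closedBall s r).indicator (fun _ => (1 : ℝ)) u * f u ^ 2 := by
    rw [norm_toLp_sq]
    refine integral_congr_ae (ae_of_all _ fun u => ?_)
    by_cases h : u ∈ Metric.closedBall s r <;> simp [h]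
  rw [h1, ← h2]
  calc _ ≤ (‖windowVec hc hb r s‖ * ‖hf.toLp _‖) ^ 2 :=
        sq_le_sq.2 (by rw [abs_of_nonneg (by positivity : 0 ≤ ‖windowVec hc hb r s‖ * ‖hf.toLp _‖)]
                       exact abs_real_inner_le_norm _ _)
    _ ≤ _ := by rw [mul_pow]; gcongr; exact norm_windowVec_sq_le hc hb r hr s

theorem windowForm_self_le (hr : 0 ≤ r) {S : Set (Fin d → ℝ)} (hS : volume S ≠ ⊤)
    (f : Lp ℝ 2 (volume : Measure (Fin d → ℝ))) :
    windowForm hc hb r hr hS f f ≤ ((2 * r) ^ d) ^ 2 * ‖f‖ ^ 2 := by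
  have : IsFiniteMeasure (volume.restrict S) :=
    ⟨by rw [Measure.restrict_apply_univ]; exact hS.lt_top⟩
  have hf2 : Integrable (fun u => f u ^ 2) := (Lp.memLp f).integrable_sq
  have hint : Integrable (fun p : (Fin d → ℝ) × (Fin d → ℝ) =>
      (Metric.closedBall p.1 r).indicator (fun _ => (1 : ℝ)) p.2 * f p.2 ^ 2)
      ((volume.restrict S).prod volume) := by
    refine (hf2.comp_snd (volume.restrict S)).bdd_mul (c := 1)
      (measurable_window r).aestronglyMeasurable (ae_of_all _ fun p => ?_)
    by_cases h : p.2 ∈ Metric.closedBall p.1 r <;> simp [h]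
  rw [windowForm_apply]
  calc _ ≤ ∫ s in S, (2 * r) ^ d *
          ∫ u, (Metric.closedBall s r).indicator (fun _ => (1 : ℝ)) u * f u ^ 2 := by
        refine integral_mono (integrableOn_inner_windowVec hc hb r hr hS f f)
          (hint.integral_prod_left.const_mul _) fun s => ?_
        simp only [← sq]
        exact inner_windowVec_sq_le hc hb r hr s f
    _ = (2 * r) ^ d * ∫ u, ∫ s in S,
          (Metric.closedBall s r).indicator (fun _ => (1 : ℝ)) u * f u ^ 2 := by
        rw [integral_const_mul, integral_integral_swap hint]
    _ ≤ (2 * r) ^ d * ∫ u, (2 * r) ^ d * f u ^ 2 := by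
        refine mul_le_mul_of_nonneg_left ?_ (by positivity)
        refine integral_mono hint.integral_prod_right (hf2.const_mul _) fun u => ?_
        simp only [integral_mul_const]
        refine mul_le_mul_of_nonneg_right ?_ (sq_nonneg _)
        have hflip : ∀ s, (Metric.closedBall s r).indicator (fun _ => (1 : ℝ)) u =
            (Metric.closedBall u r).indicator (fun _ => (1 : ℝ)) s := fun s => by
          simp only [Set.indicator, Metric.mem_closedBall, dist_comm]
        simp only [hflip]
        rw [integral_indicator measurableSet_closedBall]
        simp only [integral_const, smul_eq_mul, mul_one, Measure.restrict_restrict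
          measurableSet_closedBall, measureReal_restrict_apply MeasurableSet.univ, Set.univ_inter]
        rw [← volume_real_closedBall u hr]
        exact measureReal_mono Set.inter_subset_left measure_closedBall_lt_top.ne
    _ = _ := by
        rw [integral_const_mul, ← mul_assoc, ← sq]
        congr 1
        rw [← norm_toLp_sq (Lp.memLp f), Lp.toLp_coeFn]

end Window

/-! ### Autocorrelations -/

/-- The (complex) autocorrelation of `κ`. -/
noncomputable def cacorr {d : ℕ} (κ : (Fin d → ℝ) → ℂ) (x : Fin d → ℝ) : ℂ :=
  ∫ t, κ (x + t) * starRingEnd ℂ (κ t)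

/-- The real part of the autocorrelation of `κ`. -/
noncomputable def acorr {d : ℕ} (κ : (Fin d → ℝ) → ℂ) (x : Fin d → ℝ) : ℝ := (cacorr κ x).re

section Autocorrelation

variable {d : ℕ} {κ : (Fin d → ℝ) → ℂ}

theorem cacorr_sub (κ : (Fin d → ℝ) → ℂ) (x y : Fin d → ℝ) :
    cacorr κ (x - y) = ∫ s, κ (x - s) * starRingEnd ℂ (κ (y - s)) := by
  rw [cacorr, ← integral_sub_left_eq_self _ volume y]
  congr 1 with s
  congr 2
  abel_nf

theorem cacorr_neg (κ : (Fin d → ℝ) → ℂ) (x : Fin d → ℝ) :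
    cacorr κ (-x) = starRingEnd ℂ (cacorr κ x) := by
  rw [cacorr, cacorr, ← integral_conj, ← integral_add_left_eq_self _ x]
  congr 1 with s
  simp [mul_comm]

theorem acorr_neg (κ : (Fin d → ℝ) → ℂ) (x : Fin d → ℝ) : acorr κ x = acorr κ (-x) := by
  rw [acorr, acorr, cacorr_neg, Complex.conj_re]

theorem cacorr_eq_convolution (κ : (Fin d → ℝ) → ℂ) (x : Fin d → ℝ) :
    cacorr κ x = convolution (fun t => starRingEnd ℂ (κ (-t))) κ
      (ContinuousLinearMap.mul ℝ ℂ) volume x := by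
  rw [convolution_def, cacorr, ← integral_neg_eq_self]
  congr 1 with s
  rw [ContinuousLinearMap.mul_apply', mul_comm, sub_eq_add_neg]

theorem continuous_cacorr (hκ : Continuous κ) (hs : HasCompactSupport κ) :
    Continuous (cacorr κ) := by
  have : cacorr κ = convolution (fun t => starRingEnd ℂ (κ (-t))) κ
      (ContinuousLinearMap.mul ℝ ℂ) volume := funext (cacorr_eq_convolution κ)
  rw [this]
  have hc : Continuous fun t => starRingEnd ℂ (κ (-t)) := by fun_prop
  exact hs.continuous_convolution_right _ hc.locallyIntegrable hκ

theorem continuous_acorr (hκ : Continuous κ) (hs : HasCompactSupport κ) :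
    Continuous (acorr κ) :=
  Complex.continuous_re.comp (continuous_cacorr hκ hs)

theorem integral_cacorr (hκ : Integrable κ) :
    ∫ x, cacorr κ x = ((‖∫ x, κ x‖ ^ 2 : ℝ) : ℂ) := by
  simp_rw [cacorr_eq_convolution]
  have hi : Integrable fun t => starRingEnd ℂ (κ (-t)) :=
    (Complex.conjCLE.toContinuousLinearMap.integrable_comp hκ.comp_neg)
  rw [integral_convolution _ hi hκ, integral_conj, integral_neg_eq_self κ,
    ContinuousLinearMap.mul_apply', ← Complex.normSq_eq_conj_mul_self, Complex.normSq_eq_norm_sq]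

theorem hasCompactSupport_of_forall_norm {F : Type*} [Zero F] {f : (Fin d → ℝ) → F} {ρ : ℝ}
    (hs : ∀ x, ρ < ‖x‖ → f x = 0) : HasCompactSupport f :=
  HasCompactSupport.intro (isCompact_closedBall 0 ρ) fun x hx => hs x (by simpa using hx)

theorem sum_sum_acorr_nonneg (hκ : Continuous κ) (hs : HasCompactSupport κ) {N : ℕ}
    (p : Fin N → Fin d → ℝ) (y : Fin N → ℝ) :
    0 ≤ ∑ i, ∑ j, y i * acorr κ (p i - p j) * y j := by
  have hint : ∀ i j, Integrable fun s =>
      (y i : ℂ) * (κ (p i - s) * starRingEnd ℂ (κ (p j - s))) * y j := fun i j => by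
    refine (Integrable.const_mul ?_ _).mul_const _
    have hc : Continuous fun s => κ (p i - s) * starRingEnd ℂ (κ (p j - s)) := by fun_prop
    refine hc.integrable_of_hasCompactSupport ?_
    exact (hs.comp_homeomorph (Homeomorph.subLeft (p i))).mul_right
  have h : ((∑ i, ∑ j, y i * acorr κ (p i - p j) * y j : ℝ)) =
      ∫ s, ‖∑ i, (y i : ℂ) * κ (p i - s)‖ ^ 2 := by
    have h1 : ∀ s, ((‖∑ i, (y i : ℂ) * κ (p i - s)‖ ^ 2 : ℝ) : ℂ) =
        ∑ i, ∑ j, (y i : ℂ) * (κ (p i - s) * starRingEnd ℂ (κ (p j - s))) * y j := fun s => by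
      rw [← Complex.normSq_eq_norm_sq, Complex.normSq_eq_conj_mul_self, mul_comm, map_sum,
        Finset.sum_mul_sum]
      refine Finset.sum_congr rfl fun i _ => Finset.sum_congr rfl fun j _ => ?_
      rw [map_mul, Complex.conj_ofReal]
      ring
    have h2 : ((∫ s, ‖∑ i, (y i : ℂ) * κ (p i - s)‖ ^ 2 : ℝ) : ℂ) =
        ∑ i, ∑ j, (y i : ℂ) * cacorr κ (p i - p j) * y j := by
      rw [← integral_complex_ofReal]
      simp_rw [h1]
      rw [integral_finsetSum _ fun i _ => integrable_finsetSum _ fun j _ => hint i j]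
      refine Finset.sum_congr rfl fun i _ => ?_
      rw [integral_finsetSum _ fun j _ => hint i j]
      refine Finset.sum_congr rfl fun j _ => ?_
      rw [integral_mul_const, integral_const_mul, cacorr_sub]
    rw [← Complex.ofReal_re (∫ s, _), h2]
    simp only [Complex.re_sum, Complex.re_mul_ofReal, Complex.re_ofReal_mul]
    rfl
  rw [h]
  exact integral_nonneg fun s => by positivity

theorem cacorr_eq_zero {ρ : ℝ} (hs : ∀ x, ρ < ‖x‖ → κ x = 0) {x : Fin d → ℝ}
    (hx : 2 * ρ < ‖x‖) : cacorr κ x = 0 := by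
  refine integral_eq_zero_of_ae (ae_of_all _ fun t => ?_)
  by_cases ht : ρ < ‖t‖
  · simp [hs t ht]
  · have : ‖x‖ ≤ ‖x + t‖ + ‖t‖ := by simpa using norm_sub_le (x + t) t
    simp [hs (x + t) (by linarith)]

theorem abs_acorr_le {ρ γ : ℝ} (hρ : 0 ≤ ρ) (hs : ∀ x, ρ < ‖x‖ → κ x = 0)
    (hγ : ∀ x, ‖κ x‖ ≤ γ) (x : Fin d → ℝ) : |acorr κ x| ≤ γ ^ 2 * (2 * ρ) ^ d := by
  refine (Complex.abs_re_le_norm _).trans ?_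
  have h0 : 0 ≤ γ := (norm_nonneg _).trans (hγ 0)
  rw [cacorr, ← setIntegral_eq_integral_of_forall_compl_eq_zero (s := Metric.closedBall 0 ρ)
    fun t ht => by rw [hs t (by simpa using ht)]; simp, ← volume_real_closedBall 0 hρ]
  refine norm_setIntegral_le_of_norm_le_const measure_closedBall_lt_top fun t _ => ?_
  rw [norm_mul, RCLike.norm_conj, sq]
  exact mul_le_mul (hγ _) (hγ _) (norm_nonneg _) h0

theorem rnorm_nonneg (x : Fin d → ℝ) : 0 ≤ rnorm x := Real.sqrt_nonneg _

theorem rnorm_le (x : Fin d → ℝ) : rnorm x ≤ √d * ‖x‖ := by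
  rw [rnorm]
  refine Real.sqrt_le_iff.2 ⟨by positivity, ?_⟩
  rw [mul_pow, Real.sq_sqrt (Nat.cast_nonneg d)]
  calc ∑ i, x i ^ 2 ≤ ∑ _i : Fin d, ‖x‖ ^ 2 := Finset.sum_le_sum fun i _ => by
        rw [← sq_abs]; exact pow_le_pow_left₀ (abs_nonneg _) (norm_le_pi_norm x i) 2
    _ = d * ‖x‖ ^ 2 := by simp

theorem continuous_rnorm : Continuous (rnorm : (Fin d → ℝ) → ℝ) := by
  unfold rnorm; fun_prop

theorem PLC_mul_acorr {β c ρ γ L : ℝ} (hβ : 0 < β) (hc : 0 ≤ c) (hρ : 0 ≤ ρ) (hκ : Continuous κ)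
    (hs : ∀ x, ρ < ‖x‖ → κ x = 0) (hγ : ∀ x, ‖κ x‖ ≤ γ)
    (hL : c * ((1 + (√d * (2 * ρ)) ^ β) * (γ ^ 2 * (2 * ρ) ^ d) * (4 * ρ) ^ d) ≤ L) :
    PLC d β L fun x => c * acorr κ x := by
  have hcs := hasCompactSupport_of_forall_norm hs
  have hcont := continuous_acorr hκ hcs
  have hz : ∀ x, 2 * ρ < ‖x‖ → (1 + rnorm x ^ β) * |c * acorr κ x| = 0 := fun x hx => by
    rw [acorr, cacorr_eq_zero hs hx]; simp
  refine ⟨by fun_prop, fun x => congrArg (c * ·) (acorr_neg κ x), ?_, ?_, fun N p y => ?_⟩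
  · have hw : Continuous fun x : Fin d → ℝ => (1 + rnorm x ^ β) * |c * acorr κ x| :=
      (continuous_const.add (continuous_rnorm.rpow_const fun _ => Or.inr hβ.le)).mul
        (by fun_prop)
    exact hw.integrable_of_hasCompactSupport (hasCompactSupport_of_forall_norm hz)
  · refine le_trans ?_ hL
    rw [← setIntegral_eq_integral_of_forall_compl_eq_zero (s := Metric.closedBall 0 (2 * ρ))
      fun t ht => hz t (by simpa using ht)]
    refine (Real.le_norm_self _).trans ?_
    have h4 : (4 * ρ) ^ d = volume.real (Metric.closedBall (0 : Fin d → ℝ) (2 * ρ)) := by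
      rw [volume_real_closedBall 0 (by positivity)]; ring
    rw [h4, ← mul_assoc]
    refine norm_setIntegral_le_of_norm_le_const measure_closedBall_lt_top fun x hx => ?_
    have hr : rnorm x ≤ √d * (2 * ρ) :=
      (rnorm_le x).trans (mul_le_mul_of_nonneg_left (by simpa using hx) (Real.sqrt_nonneg _))
    have h1 : rnorm x ^ β ≤ (√d * (2 * ρ)) ^ β := Real.rpow_le_rpow (rnorm_nonneg x) hr hβ.le
    have h0 : 0 ≤ rnorm x ^ β := Real.rpow_nonneg (rnorm_nonneg x) β
    rw [Real.norm_of_nonneg (by positivity), abs_mul, abs_of_nonneg hc, mul_left_comm]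
    gcongr
    exact abs_acorr_le hρ hs hγ x
  · have h := sum_sum_acorr_nonneg hκ hcs p y
    have h2 : ∑ i, ∑ j, y i * (c * acorr κ (p i - p j)) * y j =
        c * ∑ i, ∑ j, y i * acorr κ (p i - p j) * y j := by
      simp only [Finset.mul_sum]
      exact Finset.sum_congr rfl fun i _ => Finset.sum_congr rfl fun j _ => by ring
    rw [h2]
    positivity

end Autocorrelation

theorem PLC.add {d : ℕ} {β L₁ L₂ : ℝ} {C₁ C₂ : (Fin d → ℝ) → ℝ} (h₁ : PLC d β L₁ C₁)
    (h₂ : PLC d β L₂ C₂) : PLC d β (L₁ + L₂) fun x => C₁ x + C₂ x := by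
  obtain ⟨c1, s1, i1, b1, p1⟩ := h₁
  obtain ⟨c2, s2, i2, b2, p2⟩ := h₂
  have hle : ∀ x : Fin d → ℝ, (1 + rnorm x ^ β) * |C₁ x + C₂ x| ≤
      (1 + rnorm x ^ β) * |C₁ x| + (1 + rnorm x ^ β) * |C₂ x| := fun x => by
    rw [← mul_add]
    have : 0 ≤ rnorm x ^ β := Real.rpow_nonneg (rnorm_nonneg x) β
    exact mul_le_mul_of_nonneg_left (abs_add_le _ _) (by positivity)
  have h0 : ∀ x : Fin d → ℝ, 0 ≤ (1 + rnorm x ^ β) * |C₁ x + C₂ x| := fun x => by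
    have : 0 ≤ rnorm x ^ β := Real.rpow_nonneg (rnorm_nonneg x) β
    positivity
  refine ⟨c1.add c2, fun x => congrArg₂ (· + ·) (s1 x) (s2 x), ?_, ?_, fun N p y => ?_⟩
  · refine (i1.add i2).mono' ?_ (ae_of_all _ fun x => ?_)
    · have : Measurable fun x : Fin d → ℝ => (1 + rnorm x ^ β) * |C₁ x + C₂ x| :=
        (measurable_const.add (continuous_rnorm.measurable.pow_const β)).mul
          (c1.add c2).abs.measurable
      exact this.aestronglyMeasurable
    · rw [Real.norm_of_nonneg (h0 x)]; exact hle x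
  · calc _ ≤ ∫ x, ((1 + rnorm x ^ β) * |C₁ x| + (1 + rnorm x ^ β) * |C₂ x|) :=
          integral_mono_of_nonneg (ae_of_all _ h0) (i1.add i2) (ae_of_all _ hle)
      _ ≤ _ := by rw [integral_add i1 i2]; exact add_le_add b1 b2
  · have := add_nonneg (p1 N p y) (p2 N p y)
    simp only [← Finset.sum_add_distrib] at this
    simpa only [mul_add, add_mul] using this

theorem PLC.mono {d : ℕ} {β L₁ L₂ : ℝ} {C : (Fin d → ℝ) → ℝ} (h : PLC d β L₁ C) (hL : L₁ ≤ L₂) :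
    PLC d β L₂ C :=
  ⟨h.1, h.2.1, h.2.2.1, h.2.2.2.1.trans hL, h.2.2.2.2⟩

/-! ### Plane waves and spectral values -/

/-- The plane wave `x ↦ e^{i x·θ}`. -/
noncomputable def planeWave {d : ℕ} (θ x : Fin d → ℝ) : ℂ :=
  Complex.exp (Complex.I * ∑ i, x i * θ i)

section PlaneWave

variable {d : ℕ} {κ : (Fin d → ℝ) → ℂ} (θ : Fin d → ℝ)

theorem planeWave_eq (x : Fin d → ℝ) :
    planeWave θ x = Complex.exp ((∑ i, x i * θ i : ℝ) * Complex.I) := by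
  rw [planeWave, mul_comm]

theorem norm_planeWave (x : Fin d → ℝ) : ‖planeWave θ x‖ = 1 := by
  rw [planeWave_eq, Complex.norm_exp_ofReal_mul_I]

theorem planeWave_add (x y : Fin d → ℝ) :
    planeWave θ (x + y) = planeWave θ x * planeWave θ y := by
  simp only [planeWave, ← Complex.exp_add, ← mul_add, ← Complex.ofReal_add,
    ← Finset.sum_add_distrib, Pi.add_apply, add_mul]

theorem planeWave_neg_left (x : Fin d → ℝ) : planeWave (-θ) x = planeWave θ (-x) := by
  simp [planeWave]

theorem conj_planeWave (x : Fin d → ℝ) :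
    starRingEnd ℂ (planeWave θ x) = planeWave θ (-x) := by
  rw [planeWave, planeWave, ← Complex.exp_conj]
  simp

theorem planeWave_mul_conj (x : Fin d → ℝ) :
    planeWave θ x * starRingEnd ℂ (planeWave θ x) = 1 := by
  rw [Complex.mul_conj, Complex.normSq_eq_norm_sq, norm_planeWave]
  simp

theorem planeWave_re (x : Fin d → ℝ) : (planeWave θ x).re = Real.cos (∑ i, x i * θ i) := by
  rw [planeWave_eq, Complex.exp_ofReal_mul_I_re]

theorem continuous_planeWave : Continuous (planeWave θ) := by
  unfold planeWave; fun_prop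

theorem cacorr_mul_planeWave (x : Fin d → ℝ) :
    cacorr κ x * planeWave θ x = cacorr (fun u => κ u * planeWave θ u) x := by
  rw [cacorr, cacorr, ← integral_mul_const]
  congr 1 with t
  rw [planeWave_add, map_mul]
  linear_combination (-κ (x + t) * starRingEnd ℂ (κ t) * planeWave θ x) * planeWave_mul_conj θ t

theorem integral_cacorr_mul_planeWave (hκ : Continuous κ) (hs : HasCompactSupport κ) :
    ∫ x, cacorr κ x * planeWave θ x = ((‖∫ x, κ x * planeWave θ x‖ ^ 2 : ℝ) : ℂ) := by
  simp_rw [cacorr_mul_planeWave]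
  exact integral_cacorr
    ((hκ.mul (continuous_planeWave θ)).integrable_of_hasCompactSupport hs.mul_right)

theorem hasCompactSupport_cacorr {ρ : ℝ} (hs : ∀ x, ρ < ‖x‖ → κ x = 0) :
    HasCompactSupport (cacorr κ) :=
  hasCompactSupport_of_forall_norm fun _ hx => cacorr_eq_zero hs hx

theorem integrable_cacorr_mul_planeWave {ρ : ℝ} (hκ : Continuous κ)
    (hs : ∀ x, ρ < ‖x‖ → κ x = 0) : Integrable fun x => cacorr κ x * planeWave θ x :=
  ((continuous_cacorr hκ (hasCompactSupport_of_forall_norm hs)).mul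
    (continuous_planeWave θ)).integrable_of_hasCompactSupport
      (hasCompactSupport_cacorr hs).mul_right

theorem acorr_mul_planeWave (x : Fin d → ℝ) :
    (acorr κ x : ℂ) * planeWave θ x =
      (cacorr κ x * planeWave θ x + cacorr κ (-x) * planeWave (-θ) (-x)) / 2 := by
  rw [cacorr_neg, planeWave_neg_left, neg_neg, acorr, Complex.re_eq_add_conj]
  ring

theorem integrable_acorr_mul_planeWave {ρ : ℝ} (hκ : Continuous κ)
    (hs : ∀ x, ρ < ‖x‖ → κ x = 0) : Integrable fun x => (acorr κ x : ℂ) * planeWave θ x := by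
  simp_rw [acorr_mul_planeWave]
  exact ((integrable_cacorr_mul_planeWave θ hκ hs).add
    (integrable_cacorr_mul_planeWave (-θ) hκ hs).comp_neg).div_const _

theorem le_re_integral_acorr_mul_planeWave {ρ : ℝ} (hκ : Continuous κ)
    (hs : ∀ x, ρ < ‖x‖ → κ x = 0) :
    ‖∫ x, κ x * planeWave (-θ) x‖ ^ 2 / 2 ≤ (∫ x, (acorr κ x : ℂ) * planeWave θ x).re := by
  have hcs := hasCompactSupport_of_forall_norm hs
  have h : ∫ x, (acorr κ x : ℂ) * planeWave θ x =
      (((‖∫ x, κ x * planeWave θ x‖ ^ 2 + ‖∫ x, κ x * planeWave (-θ) x‖ ^ 2) / 2 : ℝ) : ℂ) := by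
    simp_rw [acorr_mul_planeWave]
    rw [integral_div, integral_add (integrable_cacorr_mul_planeWave θ hκ hs)
      (integrable_cacorr_mul_planeWave (-θ) hκ hs).comp_neg,
      integral_neg_eq_self (fun x => cacorr κ x * planeWave (-θ) x),
      integral_cacorr_mul_planeWave θ hκ hcs, integral_cacorr_mul_planeWave (-θ) hκ hcs]
    push_cast
    rfl
  rw [h, Complex.ofReal_re]
  linarith [sq_nonneg ‖∫ x, κ x * planeWave θ x‖]

theorem le_specValC_add_mul_acorr {ρ ρ₀ c₀ c : ℝ} {κ₀ : (Fin d → ℝ) → ℂ} (hκ₀ : Continuous κ₀)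
    (hs₀ : ∀ x, ρ₀ < ‖x‖ → κ₀ x = 0) (hκ : Continuous κ) (hs : ∀ x, ρ < ‖x‖ → κ x = 0)
    (hc : 0 ≤ c) :
    specValC d (fun x => c₀ * acorr κ₀ x) θ +
        ((2 * Real.pi) ^ d)⁻¹ * (c * (‖∫ x, κ x * planeWave (-θ) x‖ ^ 2 / 2)) ≤
      specValC d (fun x => c₀ * acorr κ₀ x + c * acorr κ x) θ := by
  have hi₀ := (integrable_acorr_mul_planeWave θ hκ₀ hs₀).const_mul (c₀ : ℂ)
  have hi := (integrable_acorr_mul_planeWave θ hκ hs).const_mul (c : ℂ)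
  have h : ∀ x, ((c₀ * acorr κ₀ x + c * acorr κ x : ℝ) : ℂ) * planeWave θ x =
      c₀ * ((acorr κ₀ x : ℂ) * planeWave θ x) + c * ((acorr κ x : ℂ) * planeWave θ x) := fun x => by
    push_cast; ring
  have h' : ∀ x, ((c₀ * acorr κ₀ x : ℝ) : ℂ) * planeWave θ x =
      c₀ * ((acorr κ₀ x : ℂ) * planeWave θ x) := fun x => by
    push_cast; ring
  change ((2 * Real.pi) ^ d)⁻¹ * (∫ x, ((c₀ * acorr κ₀ x : ℝ) : ℂ) * planeWave θ x).re + _ ≤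
    ((2 * Real.pi) ^ d)⁻¹ *
      (∫ x, ((c₀ * acorr κ₀ x + c * acorr κ x : ℝ) : ℂ) * planeWave θ x).re
  simp_rw [h, h']
  rw [integral_add hi₀ hi, Complex.add_re, mul_add, integral_const_mul (c : ℂ),
    Complex.re_ofReal_mul]
  gcongr
  exact le_re_integral_acorr_mul_planeWave θ hκ hs

end PlaneWave

/-! ### Truncated plane waves smoothed by a bump -/

/-- The tent function of radius `a`. -/
noncomputable def tent {d : ℕ} (a : ℝ) (u : Fin d → ℝ) : ℝ := max 0 (a - ‖u‖)

/-- The plane wave truncated to the cube of radius `ℓ` and convolved with a tent. -/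
noncomputable def smoothedWave {d : ℕ} (θ : Fin d → ℝ) (a ℓ : ℝ) (x : Fin d → ℝ) : ℂ :=
  ∫ u in Metric.closedBall 0 ℓ, (tent a (x - u) : ℂ) * planeWave θ u

section SmoothedWave

variable {d : ℕ} (θ : Fin d → ℝ) {a ℓ : ℝ}

theorem continuous_tent : Continuous (tent a : (Fin d → ℝ) → ℝ) := by
  unfold tent; fun_prop

theorem tent_nonneg (u : Fin d → ℝ) : 0 ≤ tent a u := le_max_left _ _

theorem tent_eq_zero {u : Fin d → ℝ} (hu : a < ‖u‖) : tent a u = 0 :=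
  max_eq_left (by linarith)

theorem tent_le (ha : 0 ≤ a) (u : Fin d → ℝ) : tent a u ≤ a :=
  max_le ha (by linarith [norm_nonneg u])

theorem hasCompactSupport_tent : HasCompactSupport (tent a : (Fin d → ℝ) → ℝ) :=
  hasCompactSupport_of_forall_norm fun _ => tent_eq_zero

theorem integrable_tent : Integrable (tent a : (Fin d → ℝ) → ℝ) :=
  continuous_tent.integrable_of_hasCompactSupport hasCompactSupport_tent

theorem integral_tent_pos (ha : 0 < a) : 0 < ∫ u : Fin d → ℝ, tent a u :=
  continuous_tent.integral_pos_of_hasCompactSupport_nonneg_nonzero hasCompactSupport_tent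
    tent_nonneg (x := 0) (by simp [tent, ha.le, ha.ne'])

theorem smoothedWave_eq_convolution (x : Fin d → ℝ) :
    smoothedWave θ a ℓ x = convolution ((Metric.closedBall 0 ℓ).indicator (planeWave θ))
      (fun u => (tent a u : ℂ)) (ContinuousLinearMap.mul ℝ ℂ) volume x := by
  rw [convolution_def, smoothedWave, ← integral_indicator measurableSet_closedBall]
  congr 1 with u
  by_cases hu : u ∈ Metric.closedBall (0 : Fin d → ℝ) ℓ <;> simp [hu, mul_comm]

theorem integrable_indicator_planeWave (s : Fin d → ℝ) :
    Integrable ((Metric.closedBall s ℓ).indicator (planeWave θ)) :=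
  ((continuous_planeWave θ).continuousOn.integrableOn_compact
    (isCompact_closedBall s ℓ)).integrable_indicator measurableSet_closedBall

theorem continuous_smoothedWave : Continuous (smoothedWave θ a ℓ) := by
  have : smoothedWave θ a ℓ = convolution ((Metric.closedBall 0 ℓ).indicator (planeWave θ))
      (fun u => (tent a u : ℂ)) (ContinuousLinearMap.mul ℝ ℂ) volume :=
    funext (smoothedWave_eq_convolution θ)
  rw [this]
  exact (hasCompactSupport_tent.comp_left Complex.ofReal_zero).continuous_convolution_right _
    (integrable_indicator_planeWave θ 0).locallyIntegrable
    (Complex.continuous_ofReal.comp continuous_tent)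

theorem smoothedWave_eq_zero {x : Fin d → ℝ} (hx : ℓ + a < ‖x‖) : smoothedWave θ a ℓ x = 0 := by
  refine setIntegral_eq_zero_of_forall_eq_zero fun u hu => ?_
  have h1 : ‖u‖ ≤ ℓ := by simpa using hu
  have h2 := norm_sub_norm_le x u
  rw [tent_eq_zero (by linarith)]
  simp

theorem norm_smoothedWave_le (x : Fin d → ℝ) :
    ‖smoothedWave θ a ℓ x‖ ≤ ∫ u : Fin d → ℝ, tent a u := by
  have hi : Integrable fun u : Fin d → ℝ => tent a (x - u) := integrable_tent.comp_sub_left x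
  rw [← integral_sub_left_eq_self _ volume x]
  refine (norm_integral_le_of_norm_le hi.integrableOn (ae_of_all _ fun u => ?_)).trans
    (setIntegral_le_integral hi (ae_of_all _ fun u => tent_nonneg _))
  rw [norm_mul, norm_planeWave, mul_one, Complex.norm_real, Real.norm_of_nonneg (tent_nonneg _)]

theorem integral_smoothedWave_mul_planeWave (hℓ : 0 ≤ ℓ) :
    ∫ x, smoothedWave θ a ℓ x * planeWave (-θ) x =
      ((2 * ℓ) ^ d : ℝ) * ∫ u, (tent a u : ℂ) * planeWave (-θ) u := by
  have h : ∀ x, smoothedWave θ a ℓ x * planeWave (-θ) x =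
      convolution ((Metric.closedBall 0 ℓ).indicator fun _ => (1 : ℂ))
        (fun u => (tent a u : ℂ) * planeWave (-θ) u) (ContinuousLinearMap.mul ℝ ℂ) volume x := by
    intro x
    rw [convolution_def, smoothedWave, ← integral_mul_const,
      ← integral_indicator measurableSet_closedBall]
    congr 1 with u
    by_cases hu : u ∈ Metric.closedBall (0 : Fin d → ℝ) ℓ
    · have h1 : planeWave (-θ) x = planeWave (-θ) (x - u) * planeWave (-θ) u := by
        rw [← planeWave_add, sub_add_cancel]
      have h2 : planeWave (-θ) u * planeWave θ u = 1 := by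
        rw [planeWave_neg_left, ← conj_planeWave, mul_comm, planeWave_mul_conj]
      simp only [Set.indicator_of_mem hu, ContinuousLinearMap.mul_apply', one_mul]
      rw [h1]
      linear_combination (tent a (x - u) * planeWave (-θ) (x - u) : ℂ) * h2
    · simp [hu]
  have hc : Continuous fun u => (tent a u : ℂ) * planeWave (-θ) u :=
    (Complex.continuous_ofReal.comp continuous_tent).mul (continuous_planeWave _)
  have hcs : HasCompactSupport fun u => (tent a u : ℂ) * planeWave (-θ) u :=
    (hasCompactSupport_tent.comp_left Complex.ofReal_zero).mul_right
  simp_rw [h]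
  rw [integral_convolution _ ?_ (hc.integrable_of_hasCompactSupport hcs),
    ContinuousLinearMap.mul_apply', integral_indicator_const _ measurableSet_closedBall,
    volume_real_closedBall 0 hℓ]
  · simp
  · exact (integrable_indicator_iff measurableSet_closedBall).2
      (integrableOn_const measure_closedBall_lt_top.ne)

theorem le_norm_integral_tent_mul_planeWave (ha : a * ∑ i, |θ i| ≤ 1) :
    Real.cos 1 * ∫ u : Fin d → ℝ, tent a u ≤ ‖∫ u, (tent a u : ℂ) * planeWave (-θ) u‖ := by
  have hc : Continuous fun u => (tent a u : ℂ) * planeWave (-θ) u :=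
    (Complex.continuous_ofReal.comp continuous_tent).mul (continuous_planeWave _)
  have hcs : HasCompactSupport fun u => (tent a u : ℂ) * planeWave (-θ) u :=
    (hasCompactSupport_tent.comp_left Complex.ofReal_zero).mul_right
  have hi := hc.integrable_of_hasCompactSupport (μ := volume) hcs
  refine le_trans ?_ (Complex.re_le_norm _)
  have hre : (∫ u, (tent a u : ℂ) * planeWave (-θ) u).re =
      ∫ u, ((tent a u : ℂ) * planeWave (-θ) u).re := (integral_re hi).symm
  rw [hre, ← integral_const_mul]
  refine integral_mono (integrable_tent.const_mul _) hi.re fun u => ?_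
  change Real.cos 1 * tent a u ≤ ((tent a u : ℂ) * planeWave (-θ) u).re
  rw [Complex.re_ofReal_mul, planeWave_re, mul_comm]
  by_cases hu : a < ‖u‖
  · simp [tent_eq_zero hu]
  · refine mul_le_mul_of_nonneg_left ?_ (tent_nonneg _)
    have h : |∑ i, u i * (-θ) i| ≤ 1 := by
      refine le_trans ((Finset.abs_sum_le_sum_abs _ _).trans ?_) ha
      rw [Finset.mul_sum]
      refine Finset.sum_le_sum fun i _ => ?_
      rw [abs_mul, Pi.neg_apply, abs_neg]
      exact mul_le_mul_of_nonneg_right ((norm_le_pi_norm u i).trans (not_lt.1 hu)) (abs_nonneg _)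
    rw [← Real.cos_abs (∑ i, _)]
    exact Real.cos_le_cos_of_nonneg_of_le_pi (abs_nonneg _) (by linarith [Real.pi_gt_three]) h

end SmoothedWave

/-! ### Representing the covariances in `L²` -/

section Representation

variable {d : ℕ} (θ : Fin d → ℝ) {a ℓ : ℝ}

theorem memLp_tent_sub (b : ℝ) (x : Fin d → ℝ) :
    MemLp (fun u : Fin d → ℝ => b * tent a (x - u)) 2 volume := by
  have hc : Continuous fun u : Fin d → ℝ => b * tent a (x - u) :=
    continuous_const.mul (continuous_tent.comp (by fun_prop))
  refine hc.memLp_of_hasCompactSupport ?_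
  exact (hasCompactSupport_tent.comp_homeomorph (Homeomorph.subLeft x)).mul_left

/-- The element `u ↦ b · tent (x - u)` of `L²`. -/
noncomputable def tentVec (a b : ℝ) (x : Fin d → ℝ) : Lp ℝ 2 (volume : Measure (Fin d → ℝ)) :=
  (memLp_tent_sub (a := a) b x).toLp _

theorem inner_tentVec (b : ℝ) (x y : Fin d → ℝ) :
    inner ℝ (tentVec a b x) (tentVec a b y) =
      b ^ 2 * acorr (fun u => (tent a u : ℂ)) (x - y) := by
  have h : ∀ s : Fin d → ℝ, ((tent a (x - s) : ℂ)) * starRingEnd ℂ (tent a (y - s) : ℂ) =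
      ((tent a (x - s) * tent a (y - s) : ℝ) : ℂ) := fun s => by
    rw [Complex.conj_ofReal]; push_cast; rfl
  rw [acorr, cacorr_sub]
  simp_rw [h]
  rw [integral_complex_ofReal, Complex.ofReal_re, tentVec, inner_toLp, ← integral_const_mul]
  refine integral_congr_ae ?_
  filter_upwards [(memLp_tent_sub (a := a) b y).coeFn_toLp] with u hu
  rw [tentVec, hu]
  ring

/-- The local wave coefficient of a tent centred at `x`. -/
noncomputable def waveCoeff (a ℓ : ℝ) (s x : Fin d → ℝ) : ℂ :=
  ∫ u in Metric.closedBall s ℓ, (tent a (x - u) : ℂ) * planeWave θ u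

theorem waveCoeff_eq (s x : Fin d → ℝ) :
    waveCoeff θ a ℓ s x = planeWave θ s * smoothedWave θ a ℓ (x - s) := by
  rw [waveCoeff, smoothedWave, ← integral_indicator measurableSet_closedBall,
    ← integral_indicator measurableSet_closedBall, ← integral_const_mul,
    ← integral_add_left_eq_self _ s]
  congr 1 with u
  by_cases hu : u ∈ Metric.closedBall (0 : Fin d → ℝ) ℓ
  · have hu' : s + u ∈ Metric.closedBall s ℓ := by simpa using hu
    rw [Set.indicator_of_mem hu, Set.indicator_of_mem hu', planeWave_add, sub_add_eq_sub_sub]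
    ring
  · have hu' : s + u ∉ Metric.closedBall s ℓ := by simpa using hu
    simp [hu, hu']

theorem integrableOn_tent_mul_planeWave (s x : Fin d → ℝ) :
    IntegrableOn (fun u => (tent a (x - u) : ℂ) * planeWave θ u) (Metric.closedBall s ℓ) := by
  have hc : Continuous fun u => (tent a (x - u) : ℂ) * planeWave θ u :=
    (Complex.continuous_ofReal.comp (continuous_tent.comp (by fun_prop))).mul
      (continuous_planeWave _)
  exact hc.continuousOn.integrableOn_compact (isCompact_closedBall s ℓ)

theorem measurable_planeWave_re : Measurable fun u => (planeWave θ u).re :=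
  (Complex.continuous_re.comp (continuous_planeWave θ)).measurable

theorem measurable_planeWave_im : Measurable fun u => (planeWave θ u).im :=
  (Complex.continuous_im.comp (continuous_planeWave θ)).measurable

theorem abs_planeWave_re_le (u : Fin d → ℝ) : |(planeWave θ u).re| ≤ 1 :=
  (Complex.abs_re_le_norm _).trans (norm_planeWave θ u).le

theorem abs_planeWave_im_le (u : Fin d → ℝ) : |(planeWave θ u).im| ≤ 1 :=
  (Complex.abs_im_le_norm _).trans (norm_planeWave θ u).le

theorem inner_windowVec_tentVec {c : (Fin d → ℝ) → ℝ} (hc : Measurable c) (hb : ∀ u, |c u| ≤ 1)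
    (b : ℝ) (s x : Fin d → ℝ) :
    inner ℝ (windowVec hc hb ℓ s) (tentVec a b x) =
      b * ∫ u in Metric.closedBall s ℓ, tent a (x - u) * c u := by
  rw [inner_windowVec, ← integral_const_mul, ← integral_indicator measurableSet_closedBall]
  refine integral_congr_ae ?_
  filter_upwards [(memLp_tent_sub (a := a) b x).coeFn_toLp] with u hu
  rw [tentVec, hu]
  by_cases h : u ∈ Metric.closedBall s ℓ
  · simp only [Set.indicator_of_mem h]; ring
  · simp [h]

theorem inner_windowVec_re (b : ℝ) (s x : Fin d → ℝ) :
    inner ℝ (windowVec (measurable_planeWave_re θ) (abs_planeWave_re_le θ) ℓ s) (tentVec a b x) =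
      b * (waveCoeff θ a ℓ s x).re := by
  have h : (waveCoeff θ a ℓ s x).re =
      ∫ u in Metric.closedBall s ℓ, ((tent a (x - u) : ℂ) * planeWave θ u).re :=
    (integral_re (integrableOn_tent_mul_planeWave θ s x)).symm
  rw [inner_windowVec_tentVec, h]
  simp_rw [Complex.re_ofReal_mul]

theorem inner_windowVec_im (b : ℝ) (s x : Fin d → ℝ) :
    inner ℝ (windowVec (measurable_planeWave_im θ) (abs_planeWave_im_le θ) ℓ s) (tentVec a b x) =
      b * (waveCoeff θ a ℓ s x).im := by
  have h : (waveCoeff θ a ℓ s x).im =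
      ∫ u in Metric.closedBall s ℓ, ((tent a (x - u) : ℂ) * planeWave θ u).im :=
    (integral_im (integrableOn_tent_mul_planeWave θ s x)).symm
  rw [inner_windowVec_tentVec, h]
  simp_rw [Complex.im_ofReal_mul]

theorem acorr_smoothedWave {N : ℝ} (x y : Fin d → ℝ) (hx : ‖x‖ ≤ N) :
    acorr (smoothedWave θ a ℓ) (x - y) = ∫ s in Metric.closedBall 0 (N + ℓ + a),
      ((waveCoeff θ a ℓ s x).re * (waveCoeff θ a ℓ s y).re +
        (waveCoeff θ a ℓ s x).im * (waveCoeff θ a ℓ s y).im) := by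
  have hcs : HasCompactSupport (smoothedWave θ a ℓ) :=
    hasCompactSupport_of_forall_norm fun _ => smoothedWave_eq_zero θ
  have hi : Integrable fun s => smoothedWave θ a ℓ (x - s) *
      starRingEnd ℂ (smoothedWave θ a ℓ (y - s)) := by
    have hc := continuous_smoothedWave θ (a := a) (ℓ := ℓ)
    have hc' : Continuous fun s => smoothedWave θ a ℓ (x - s) *
        starRingEnd ℂ (smoothedWave θ a ℓ (y - s)) := by fun_prop
    exact hc'.integrable_of_hasCompactSupport
      (hcs.comp_homeomorph (Homeomorph.subLeft x)).mul_right
  have hre : acorr (smoothedWave θ a ℓ) (x - y) = ∫ s, (smoothedWave θ a ℓ (x - s) *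
      starRingEnd ℂ (smoothedWave θ a ℓ (y - s))).re := by
    rw [acorr, cacorr_sub]
    exact (integral_re hi).symm
  rw [hre, ← setIntegral_eq_integral_of_forall_compl_eq_zero
    (s := Metric.closedBall 0 (N + ℓ + a)) fun s hs => ?_]
  · congr 1 with s
    have h1 : waveCoeff θ a ℓ s x * starRingEnd ℂ (waveCoeff θ a ℓ s y) =
        smoothedWave θ a ℓ (x - s) * starRingEnd ℂ (smoothedWave θ a ℓ (y - s)) := by
      rw [waveCoeff_eq, waveCoeff_eq, map_mul]
      linear_combination (smoothedWave θ a ℓ (x - s) *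
        starRingEnd ℂ (smoothedWave θ a ℓ (y - s))) * planeWave_mul_conj θ s
    rw [← h1, Complex.mul_re, Complex.conj_re, Complex.conj_im]
    ring
  · have h1 : N + ℓ + a < ‖s‖ := by simpa using hs
    have h2 := norm_sub_norm_le s x
    rw [norm_sub_rev] at h2
    rw [smoothedWave_eq_zero θ (by linarith)]
    simp

end Representation

/-! ### A pair of hard-to-distinguish Gaussian laws -/

theorem exists_gaussian_pair_s13 {d : ℕ} {T : Type*} [Fintype T] (θ : Fin d → ℝ) (x : T → Fin d → ℝ)
    {N a ℓ b ε : ℝ} (hx : ∀ j, ‖x j‖ ≤ N) (hb : 0 < b) (hε : 0 ≤ ε) (hℓ : 0 ≤ ℓ)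
    (hR : 0 ≤ N + ℓ + a) :
    ∃ P₀ P₁ : Measure (T → ℝ),
      IsCenteredGaussianCov P₀
        (Matrix.of fun j k => b ^ 2 * acorr (fun u => (tent a u : ℂ)) (x j - x k)) ∧
      IsCenteredGaussianCov P₁
        (Matrix.of fun j k => b ^ 2 * acorr (fun u => (tent a u : ℂ)) (x j - x k) +
          ε * acorr (smoothedWave θ a ℓ) (x j - x k)) ∧
      ∀ A, MeasurableSet A → Real.exp (-((ε / b ^ 2 * (2 * ((2 * ℓ) ^ d) ^ 2)) *
        (ε / b ^ 2 * (2 * ((2 * ℓ) ^ d * (2 * (N + ℓ + a)) ^ d)))) / 16) ≤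
          √(P₀ A).toReal + √(P₁ Aᶜ).toReal := by
  have hS : volume (Metric.closedBall (0 : Fin d → ℝ) (N + ℓ + a)) ≠ ⊤ :=
    measure_closedBall_lt_top.ne
  let W₁ := windowForm (measurable_planeWave_re θ) (abs_planeWave_re_le θ) ℓ hℓ hS
  let W₂ := windowForm (measurable_planeWave_im θ) (abs_planeWave_im_le θ) ℓ hℓ hS
  have hη : 0 ≤ ε / b ^ 2 := by positivity
  have hB : ∀ f g, ((ε / b ^ 2) • (W₁ + W₂)) f g = ε / b ^ 2 * (W₁ f g + W₂ f g) :=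
    fun f g => rfl
  have hcov : ∀ j k, ((ε / b ^ 2) • (W₁ + W₂)) (tentVec a b (x j)) (tentVec a b (x k)) =
      ε * acorr (smoothedWave θ a ℓ) (x j - x k) := fun j k => by
    rw [hB, windowForm_apply, windowForm_apply,
      ← integral_add (integrableOn_inner_windowVec _ _ _ hℓ hS _ _)
        (integrableOn_inner_windowVec _ _ _ hℓ hS _ _), acorr_smoothedWave θ _ _ (hx j),
      ← integral_const_mul, ← integral_const_mul]
    congr 1 with s
    rw [inner_windowVec_re, inner_windowVec_re, inner_windowVec_im, inner_windowVec_im]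
    field_simp
  obtain ⟨m, M, l, hl, hV, hM, hlM⟩ := exists_simultaneous_diagonalization
    (fun j => tentVec a b (x j)) ((ε / b ^ 2) • (W₁ + W₂))
    (fun f g => by rw [hB, hB, windowForm_symm _ _ _ _ _ f g, windowForm_symm _ _ _ _ _ f g])
    (fun f => by
      rw [hB]
      exact mul_nonneg hη (add_nonneg (windowForm_self_nonneg _ _ _ _ _ f)
        (windowForm_self_nonneg _ _ _ _ _ f)))
    (κ := ε / b ^ 2 * (2 * ((2 * ℓ) ^ d) ^ 2))
    (τ := ε / b ^ 2 * (2 * ((2 * ℓ) ^ d * (2 * (N + ℓ + a)) ^ d)))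
    (fun f => by
      rw [hB, mul_assoc]
      refine mul_le_mul_of_nonneg_left ?_ hη
      linarith [windowForm_self_le (measurable_planeWave_re θ) (abs_planeWave_re_le θ) ℓ hℓ hS f,
        windowForm_self_le (measurable_planeWave_im θ) (abs_planeWave_im_le θ) ℓ hℓ hS f])
    (fun m e he => by
      simp only [hB]
      rw [← Finset.mul_sum, Finset.sum_add_distrib]
      refine mul_le_mul_of_nonneg_left ?_ hη
      have h1 := sum_windowForm_le (measurable_planeWave_re θ) (abs_planeWave_re_le θ) ℓ hℓ hS m e he
      have h2 := sum_windowForm_le (measurable_planeWave_im θ) (abs_planeWave_im_le θ) ℓ hℓ hS m e he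
      rw [volume_real_closedBall 0 hR] at h1 h2
      linarith)
    (by positivity)
  refine ⟨gaussianImage M fun _ => 1, gaussianImage M fun a => (1 + l a).toNNReal,
    isCenteredGaussianCov_gaussianImage _ _ _ fun j k => ?_,
    isCenteredGaussianCov_gaussianImage _ _ _ fun j k => ?_,
    fun A hA => exp_le_sqrt_add_sqrt_gaussianImage M l hl hV hA⟩
  · rw [Matrix.of_apply, ← inner_tentVec, hM]
    simp
  · rw [Matrix.of_apply, ← inner_tentVec, hM, ← hcov, hlM, ← Finset.sum_add_distrib]
    refine Finset.sum_congr rfl fun i _ => ?_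
    rw [Real.coe_toNNReal _ (by linarith [hl i])]
    ring

/-! ### Choice of the bandwidth -/

theorem eventually_bandwidth {β b : ℝ} {d : ℕ} (hd : 1 ≤ d) (hβ : 0 < β) (hb : 0 < b) (a : ℝ) :
    ∀ᶠ N : ℝ in atTop, 0 < N ∧ 1 ≤ b * N ^ ((d : ℝ) / (2 * β + d)) ∧
      a ≤ b * N ^ ((d : ℝ) / (2 * β + d)) ∧ b * N ^ ((d : ℝ) / (2 * β + d)) ≤ N := by
  have hd' : (0 : ℝ) < d := by exact_mod_cast hd
  have ht : (0 : ℝ) < d / (2 * β + d) := by positivity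
  have ht1 : 0 < 1 - (d : ℝ) / (2 * β + d) := by
    rw [sub_pos, div_lt_one (by positivity)]; linarith
  have h1 : Tendsto (fun N : ℝ => b * N ^ ((d : ℝ) / (2 * β + d))) atTop atTop :=
    (tendsto_rpow_atTop ht).const_mul_atTop hb
  filter_upwards [eventually_gt_atTop 0, h1.eventually_ge_atTop 1, h1.eventually_ge_atTop a,
    (tendsto_rpow_atTop ht1).eventually_ge_atTop b] with N hN h2 h3 h4
  refine ⟨hN, h2, h3, (mul_le_mul_of_nonneg_right h4 (by positivity)).trans_eq ?_⟩
  rw [← Real.rpow_add hN, sub_add_cancel, Real.rpow_one]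

/-- Two covariances in the class whose spectral values at `θ` are separated at the minimax rate
while the Gaussian laws they induce on a bounded design remain hard to distinguish. -/
theorem eventually_exists_two_point {d : ℕ} (hd : 1 ≤ d) {β L : ℝ} (hβ : 0 < β) (hL : 0 < L)
    (θ : Fin d → ℝ) :
    ∃ V : ℝ, ∀ᶠ N : ℝ in atTop, ∀ (T : Type) [Fintype T] (x : T → Fin d → ℝ),
      (∀ j, ‖x j‖ ≤ N) → ∃ C₀ C₁ : (Fin d → ℝ) → ℝ, PLC d β L C₀ ∧ PLC d β L C₁ ∧
        specValC d C₀ θ + 2 * N ^ (-((d : ℝ) * β) / (2 * β + d)) ≤ specValC d C₁ θ ∧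
        ∃ P₀ P₁ : Measure (T → ℝ),
          IsCenteredGaussianCov P₀ (Matrix.of fun j k => C₀ (x j - x k)) ∧
          IsCenteredGaussianCov P₁ (Matrix.of fun j k => C₁ (x j - x k)) ∧
          ∀ A, MeasurableSet A → Real.exp (-V / 16) ≤ √(P₀ A).toReal + √(P₁ Aᶜ).toReal := by
  have hd' : (0 : ℝ) < d := by exact_mod_cast hd
  obtain ⟨a, ha, haθ⟩ : ∃ a : ℝ, 0 < a ∧ a * ∑ i, |θ i| ≤ 1 := by
    have h : 0 ≤ ∑ i, |θ i| := Finset.sum_nonneg fun i _ => abs_nonneg _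
    refine ⟨(1 + ∑ i, |θ i|)⁻¹, by positivity, ?_⟩
    rw [inv_mul_le_iff₀ (by positivity)]
    linarith
  set γ : ℝ := ∫ u : Fin d → ℝ, tent a u
  have hγ0 : 0 < γ := integral_tent_pos ha
  set I : ℂ := ∫ u, (tent a u : ℂ) * planeWave (-θ) u with hI
  have hI0 : 0 < ‖I‖ :=
    (mul_pos Real.cos_one_pos hγ0).trans_le (le_norm_integral_tent_mul_planeWave θ haθ)
  obtain ⟨K, hK0, hK⟩ : ∃ K : ℝ, 0 < K ∧
      K = (1 + (√d * (2 * a)) ^ β) * (a ^ 2 * (2 * a) ^ d) * (4 * a) ^ d := ⟨_, by positivity, rfl⟩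
  obtain ⟨η, hη0, hη⟩ : ∃ η : ℝ, 0 < η ∧ η ^ 2 * K = L / 2 :=
    ⟨√(L / 2 / K), by positivity, by
      rw [Real.sq_sqrt (by positivity)]; field_simp⟩
  obtain ⟨ε₀, hε₀, hε⟩ : ∃ ε₀ : ℝ, 0 < ε₀ ∧
      ε₀ * ((1 + (√d * 4) ^ β) * γ ^ 2 * 32 ^ d) = L / 2 :=
    ⟨L / 2 / ((1 + (√d * 4) ^ β) * γ ^ 2 * 32 ^ d), by positivity, by field_simp⟩
  obtain ⟨b, hb, hbβ⟩ : ∃ b : ℝ, 0 < b ∧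
      2 * b ^ β = ((2 * Real.pi) ^ d)⁻¹ * (ε₀ * (4 ^ d * ‖I‖ ^ 2 / 2)) :=
    ⟨(((2 * Real.pi) ^ d)⁻¹ * (ε₀ * (4 ^ d * ‖I‖ ^ 2 / 2)) / 2) ^ β⁻¹, by positivity, by
      rw [Real.rpow_inv_rpow (by positivity) hβ.ne']; ring⟩
  refine ⟨4 * (ε₀ / η ^ 2) ^ 2 * 48 ^ d / b ^ (2 * β + d), ?_⟩
  filter_upwards [eventually_bandwidth hd hβ hb a] with N hN T _ x hx
  obtain ⟨hN0, hℓ1, haℓ, hℓN⟩ := hN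
  obtain ⟨ℓ, hℓ⟩ : ∃ ℓ, ℓ = b * N ^ ((d : ℝ) / (2 * β + d)) := ⟨_, rfl⟩
  rw [← hℓ] at hℓ1 haℓ hℓN
  have hℓ0 : 0 < ℓ := by linarith
  obtain ⟨p, hp⟩ : ∃ p, p = ℓ ^ β := ⟨_, rfl⟩
  obtain ⟨q, hq⟩ : ∃ q, q = ℓ ^ d := ⟨_, rfl⟩
  have hp1 : 1 ≤ p := hp ▸ Real.one_le_rpow hℓ1 hβ.le
  have hp0 : 0 < p := by linarith
  have hq0 : 0 < q := hq ▸ by positivity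
  have hrate : 2 * N ^ (-((d : ℝ) * β) / (2 * β + d)) = 2 * b ^ β / p := by
    rw [eq_div_iff hp0.ne', hp, hℓ, Real.mul_rpow hb.le (by positivity), ← Real.rpow_mul hN0.le]
    have : N ^ (-((d : ℝ) * β) / (2 * β + d)) * N ^ ((d : ℝ) / (2 * β + d) * β) = 1 := by
      rw [← Real.rpow_add hN0]
      convert Real.rpow_zero N using 2
      ring
    linear_combination (2 * b ^ β) * this
  have hvar : p ^ 2 * q = b ^ (2 * β + d) * N ^ d := by
    have : p ^ 2 * q = ℓ ^ (2 * β + d) := by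
      rw [Real.rpow_add hℓ0, Real.rpow_natCast, ← hq, mul_comm 2 β, Real.rpow_mul hℓ0.le, ← hp,
        Real.rpow_two]
    rw [this, hℓ, Real.mul_rpow hb.le (by positivity), ← Real.rpow_mul hN0.le,
      div_mul_cancel₀ _ (by positivity), Real.rpow_natCast]
  obtain ⟨ε, hεd⟩ : ∃ ε, ε = ε₀ / (p * q ^ 2) := ⟨_, rfl⟩
  have hε0 : 0 < ε := hεd ▸ by positivity
  have htc : Continuous fun u : Fin d → ℝ => (tent a u : ℂ) :=
    Complex.continuous_ofReal.comp continuous_tent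
  have hts : ∀ u : Fin d → ℝ, a < ‖u‖ → (tent a u : ℂ) = 0 := fun u hu => by
    rw [tent_eq_zero hu, Complex.ofReal_zero]
  have hC₀ : PLC d β (L / 2) fun z => η ^ 2 * acorr (fun u => (tent a u : ℂ)) z :=
    PLC_mul_acorr hβ (by positivity) ha.le htc hts (γ := a) (fun u => by
      rw [Complex.norm_real, Real.norm_of_nonneg (tent_nonneg u)]; exact tent_le ha.le u)
      (by rw [← hK, hη])
  have hC₁ : PLC d β (L / 2) fun z => ε * acorr (smoothedWave θ a ℓ) z := by
    refine PLC_mul_acorr hβ hε0.le (by positivity) (continuous_smoothedWave θ)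
      (fun _ => smoothedWave_eq_zero θ) (norm_smoothedWave_le θ) ?_
    calc ε * ((1 + (√d * (2 * (ℓ + a))) ^ β) * (γ ^ 2 * (2 * (ℓ + a)) ^ d) * (4 * (ℓ + a)) ^ d)
        ≤ ε * ((p + (√d * (2 * (ℓ + ℓ))) ^ β) * (γ ^ 2 * (2 * (ℓ + ℓ)) ^ d) *
            (4 * (ℓ + ℓ)) ^ d) := by gcongr
      _ = ε₀ * ((1 + (√d * 4) ^ β) * γ ^ 2 * 32 ^ d) := by
        have h1 : (√d * (2 * (ℓ + ℓ))) ^ β = (√d * 4) ^ β * p := by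
          rw [hp, ← Real.mul_rpow (by positivity) hℓ0.le]; ring_nf
        have h2 : (2 * (ℓ + ℓ)) ^ d * (4 * (ℓ + ℓ)) ^ d = 32 ^ d * q ^ 2 := by
          rw [hq, ← mul_pow, ← pow_mul, mul_comm d 2, pow_mul, ← mul_pow]; ring_nf
        calc _ = ε * ((p + (√d * (2 * (ℓ + ℓ))) ^ β) * γ ^ 2 *
              ((2 * (ℓ + ℓ)) ^ d * (4 * (ℓ + ℓ)) ^ d)) := by ring
          _ = _ := by rw [h1, h2, hεd]; field_simp
      _ = L / 2 := hε
  refine ⟨_, _, hC₀.mono (by linarith), (hC₀.add hC₁).mono (by linarith), ?_, ?_⟩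
  · refine le_trans ?_ (le_specValC_add_mul_acorr θ htc hts (continuous_smoothedWave θ)
      (fun _ => smoothedWave_eq_zero θ) hε0.le)
    have h4 : (4 : ℝ) ^ d = (2 ^ d) ^ 2 := by rw [← pow_mul, mul_comm d 2, pow_mul]; norm_num
    rw [hrate, hbβ, integral_smoothedWave_mul_planeWave θ hℓ0.le, ← hI, norm_mul,
      Complex.norm_real, Real.norm_of_nonneg (by positivity), mul_pow 2 ℓ, ← hq, hεd, h4]
    refine (congrArg _ ?_).le
    field_simp
  · obtain ⟨P₀, P₁, h₀, h₁, h⟩ := exists_gaussian_pair_s13 θ x hx hη0 hε0.le hℓ0.le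
      (a := a) (by positivity)
    refine ⟨P₀, P₁, h₀, h₁, fun A hA => le_trans ?_ (h A hA)⟩
    rw [Real.exp_le_exp]
    refine div_le_div_of_nonneg_right (neg_le_neg ?_) (by norm_num)
    calc _ ≤ ε / η ^ 2 * (2 * ((2 * ℓ) ^ d) ^ 2) *
          (ε / η ^ 2 * (2 * ((2 * ℓ) ^ d * (2 * (N + N + N)) ^ d))) := by
          gcongr; linarith
      _ = 4 * (ε₀ / η ^ 2) ^ 2 * 48 ^ d * N ^ d / (p ^ 2 * q) := by
        have h1 : ((2 : ℝ) * (N + N + N)) ^ d = 6 ^ d * N ^ d := by rw [← mul_pow]; ring_nf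
        have h2 : (48 : ℝ) ^ d = 2 ^ d * 2 ^ d * 2 ^ d * 6 ^ d := by
          rw [← mul_pow, ← mul_pow, ← mul_pow]; norm_num
        rw [h1, h2, mul_pow 2 ℓ, ← hq, hεd]
        field_simp
        ring
      _ = _ := by
        rw [hvar]; field_simp

/-! ### Reduction to two points -/

theorem le_iSup_iSup_of_le_one {ι : Type*} {κ : ι → Type*} {f : ∀ i, κ i → ℝ}
    (h1 : ∀ i j, f i j ≤ 1) (i : ι) (j : κ i) : f i j ≤ ⨆ i, ⨆ j, f i j :=
  (le_ciSup (f := f i) ⟨1, Set.forall_mem_range.2 (h1 i)⟩ j).trans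
    (le_ciSup (f := fun i => ⨆ j, f i j)
      ⟨1, Set.forall_mem_range.2 fun i => Real.iSup_le (h1 i) zero_le_one⟩ i)

theorem sq_div_four_le_of_le_sqrt_add_sqrt {e s t u : ℝ} (he : 0 ≤ e) (h : e ≤ √s + √t)
    (hs : s ≤ u) (ht : t ≤ u) (hu : 0 ≤ u) : e ^ 2 / 4 ≤ u := by
  have h1 : e ≤ 2 * √u := by linarith [Real.sqrt_le_sqrt hs, Real.sqrt_le_sqrt ht]
  have h2 := pow_le_pow_left₀ he h1 2
  rw [mul_pow, Real.sq_sqrt hu] at h2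
  linarith

/-- Theorem 6.2 (scalar real-valued case): minimax lower bound of rate
`(nδ_n)^{-dβ/(2β+d)}` for pointwise estimation of the spectral density at `θ₀ ∈ ℝ^d` over
the continuous-time power-law class `P_C(β,L)`, based on Gaussian observations on the
grid `δ_n·{1,…,n}^d` in the mixed-domain regime `nδ_n → ∞`. -/
theorem stmt13 (d : ℕ) (hd : 1 ≤ d) (β L : ℝ) (hβ : 0 < β) (hL : 0 < L)
    (θ₀ : Fin d → ℝ) (δ : ℕ → ℝ) (hδpos : ∀ n, 0 < δ n)
    (hδ : Filter.Tendsto (fun n : ℕ => (n : ℝ) * δ n) Filter.atTop Filter.atTop) :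
    0 < Filter.liminf (fun n : ℕ =>
      ⨅ fhat : {f : ((Fin d → Fin n) → ℝ) → ℝ // Measurable f},
        ⨆ C : {C : (Fin d → ℝ) → ℝ // PLC d β L C},
          ⨆ _P : {P : Measure ((Fin d → Fin n) → ℝ) //
              IsCenteredGaussianCov P (Matrix.of fun j k : Fin d → Fin n =>
                C.1 fun i => δ n * (((j i : ℕ) : ℝ) - ((k i : ℕ) : ℝ)))},
            (_P.1 {x | ((n : ℝ) * δ n) ^ (-((d : ℝ) * β) / (2 * β + d)) ≤
              |fhat.1 x - specValC d C.1 θ₀|}).toReal) Filter.atTop := by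
  obtain ⟨V, hV⟩ := eventually_exists_two_point hd hβ hL θ₀
  have hprob : ∀ (n : ℕ) (fhat : ((Fin d → Fin n) → ℝ) → ℝ) (C : {C // PLC d β L C})
      (P : {P : Measure ((Fin d → Fin n) → ℝ) //
        IsCenteredGaussianCov P (Matrix.of fun j k : Fin d → Fin n =>
          C.1 fun i => δ n * (((j i : ℕ) : ℝ) - ((k i : ℕ) : ℝ)))}),
      (P.1 {x | ((n : ℝ) * δ n) ^ (-((d : ℝ) * β) / (2 * β + d)) ≤
        |fhat x - specValC d C.1 θ₀|}).toReal ≤ 1 := fun n fhat C P => by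
    have := P.2.1
    exact measureReal_le_one
  refine lt_of_lt_of_le (by positivity : 0 < Real.exp (-V / 16) ^ 2 / 4)
    (le_liminf_of_le (isCoboundedUnder_ge_of_le atTop (x := 1) fun n => ?_) ?_)
  · refine ciInf_le_of_le ⟨0, Set.forall_mem_range.2 fun fhat =>
      Real.iSup_nonneg fun C => Real.iSup_nonneg fun P => ENNReal.toReal_nonneg⟩
      ⟨0, measurable_const⟩ ?_
    exact Real.iSup_le (fun C => Real.iSup_le (hprob n _ C) zero_le_one) zero_le_one
  filter_upwards [hδ.eventually hV] with n hn
  obtain ⟨C₀, C₁, hC₀, hC₁, hsep, P₀, P₁, hP₀, hP₁, hP⟩ := hn (Fin d → Fin n)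
    (fun j i => δ n * ((j i : ℕ) : ℝ)) fun j => by
      refine (pi_norm_le_iff_of_nonneg (mul_nonneg n.cast_nonneg (hδpos n).le)).2 fun i => ?_
      rw [norm_mul, Real.norm_of_nonneg (hδpos n).le, Real.norm_natCast, mul_comm]
      exact mul_le_mul_of_nonneg_right (by exact_mod_cast (j i).isLt.le) (hδpos n).le
  have hx : ∀ j k : Fin d → Fin n, ((fun i => δ n * ((j i : ℕ) : ℝ)) -
      fun i => δ n * ((k i : ℕ) : ℝ)) = fun i => δ n * (((j i : ℕ) : ℝ) - ((k i : ℕ) : ℝ)) :=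
    fun j k => funext fun i => (mul_sub _ _ _).symm
  simp only [hx] at hP₀ hP₁
  have : Nonempty {f : ((Fin d → Fin n) → ℝ) → ℝ // Measurable f} := ⟨⟨0, measurable_const⟩⟩
  refine le_ciInf fun fhat => ?_
  set r := ((n : ℝ) * δ n) ^ (-((d : ℝ) * β) / (2 * β + d))
  have hA : MeasurableSet {x | r ≤ |fhat.1 x - specValC d C₀ θ₀|} :=
    measurableSet_le measurable_const (fhat.2.sub_const _).abs
  have hsub : {x | r ≤ |fhat.1 x - specValC d C₀ θ₀|}ᶜ ⊆
      {x | r ≤ |fhat.1 x - specValC d C₁ θ₀|} := fun x hx => by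
    have h1 : |fhat.1 x - specValC d C₀ θ₀| < r := not_le.1 hx
    have h2 := neg_le_abs (fhat.1 x - specValC d C₁ θ₀)
    have h3 := (abs_lt.1 h1).2
    change r ≤ _
    linarith
  have := hP₁.1
  exact sq_div_four_le_of_le_sqrt_add_sqrt (Real.exp_pos _).le (hP _ hA)
    (le_iSup_iSup_of_le_one (hprob n fhat.1) ⟨C₀, hC₀⟩ ⟨P₀, hP₀⟩)
    ((ENNReal.toReal_mono (measure_ne_top _ _) (measure_mono hsub)).trans
      (le_iSup_iSup_of_le_one (hprob n fhat.1) ⟨C₁, hC₁⟩ ⟨P₁, hP₁⟩))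
    (Real.iSup_nonneg fun C => Real.iSup_nonneg fun P => ENNReal.toReal_nonneg)
end
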